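/- Let A = kQ/I be a non simply connected toupie algebra with m = dim_k e_0 A e_∞ ≥ 2 such that some branch of Q lies in the ideal I. Then A is not a laura algebra. -/

import Mathlib

/-!
Formalization preamble for "Toupie algebras".

We realize the bound quiver algebra `A = kQ/I` of a toupie quiver `Q` concretely:
the path algebra `kQ` is realized, via its (faithful) left regular representation,
as the subalgebra of `Module.End k (paths → k)` generated by the operators of left
multiplication by the trivial paths `e_v` and by the arrows of `Q`.  Paths are
composed from left to right (`p * q` = "first `p`, then `q`"), as in
Assem–Simson–Skowroński, so that paths from the source `0` to the sink `∞` span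
`e₀ (kQ) e∞`, and (right) `A`-modules are identified with representations of `(Q, I)`.
Right `A`-modules are formalized as (left) modules over `Aᵐᵒᵖ`.
-/

set_option synthInstance.maxHeartbeats 400000
set_option maxHeartbeats 800000

noncomputable section
open scoped Classical
open MulOpposite

universe u

namespace Toupie

/-- Vertices of a toupie quiver with `t` branches, branch `i` having length `ℓ i ≥ 1`:
the unique source `src`, the unique sink `snk`, and for each branch `i` its interior
vertices `mid i a` (the `(a+1)`-st vertex on branch `i`, for `a : Fin (ℓ i - 1)`). -/
inductive Vtx (t : ℕ) (ℓ : Fin t → ℕ) : Type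
  | src : Vtx t ℓ
  | snk : Vtx t ℓ
  | mid (i : Fin t) (a : Fin (ℓ i - 1)) : Vtx t ℓ

/-- The `a`-th vertex on branch `i`, for `0 ≤ a ≤ ℓ i`
(`a = 0` is the source, `a = ℓ i` is the sink). -/
def vtx (t : ℕ) (ℓ : Fin t → ℕ) (i : Fin t) (a : ℕ) : Vtx t ℓ :=
  if a = 0 then .src else if h : a - 1 < ℓ i - 1 then .mid i ⟨a - 1, h⟩ else .snk

/-- The paths of a toupie quiver: trivial paths at the vertices, and for each branch
`i` and `a < b ≤ ℓ i` the path `sub i a b` along branch `i` from its `a`-th vertex to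
its `b`-th vertex.  (`sub i 0 (ℓ i)` is the `i`-th branch `w i`.) -/
inductive PIdx (t : ℕ) (ℓ : Fin t → ℕ) : Type
  | vert (v : Vtx t ℓ) : PIdx t ℓ
  | sub (i : Fin t) (a b : ℕ) (hab : a < b) (hb : b ≤ ℓ i) : PIdx t ℓ

variable (k : Type u) [Field k] (t : ℕ) (ℓ : Fin t → ℕ)

/-- The vector space with basis the set of paths of the toupie quiver. -/
abbrev PSp : Type u := PIdx t ℓ → k

variable {t ℓ}

/-- The starting vertex of a path. -/
def startIdx : PIdx t ℓ → Vtx t ℓ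
  | .vert v => v
  | .sub i a _ _ _ => vtx t ℓ i a

/-- Left multiplication by the trivial path (primitive idempotent) `e_v`. -/
def Ev (v : Vtx t ℓ) : Module.End k (PSp k t ℓ) where
  toFun f := fun p => if startIdx p = v then f p else 0
  map_add' f g := by funext p; by_cases h : startIdx p = v <;> simp [h]
  map_smul' c f := by funext p; by_cases h : startIdx p = v <;> simp [h]

/-- Strip the `j`-th arrow of branch `i` (the arrow `vtx i j ⟶ vtx i (j+1)`) from the
front of a path, if possible. -/
def strip (i : Fin t) (j : ℕ) : PIdx t ℓ → Option (PIdx t ℓ)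
  | .vert _ => none
  | .sub i' a b _ hb =>
      if h : i' = i ∧ a = j then
        if hb2 : j + 1 < b then some (.sub i (j + 1) b hb2 (h.1 ▸ hb))
        else some (.vert (vtx t ℓ i b))
      else none

/-- Left multiplication by the `j`-th arrow of branch `i`
(the arrow from `vtx i j` to `vtx i (j+1)`, for `j < ℓ i`; the zero operator for junk `j`). -/
def Ar (i : Fin t) (j : ℕ) : Module.End k (PSp k t ℓ) where
  toFun f := fun p => (strip i j p).elim 0 f
  map_add' f g := by funext p; rcases h : strip i j p with _ | q <;> simp [h]
  map_smul' c f := by funext p; rcases h : strip i j p with _ | q <;> simp [h]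

variable (t ℓ)

/-- The generators of the path algebra: the trivial paths and the arrows. -/
def gens : Set (Module.End k (PSp k t ℓ)) :=
  Set.range (Ev k) ∪ {x | ∃ i j, x = Ar k i j}

/-- The path algebra `kQ` of the toupie quiver, realized as the subalgebra of
`Module.End k (PSp k t ℓ)` generated by left multiplication by trivial paths and arrows. -/
def PathAlg : Subalgebra k (Module.End k (PSp k t ℓ)) :=
  Algebra.adjoin k (gens k t ℓ)

variable {k t ℓ}

/-- The trivial path `e_v` as an element of the path algebra. -/
def eV (v : Vtx t ℓ) : PathAlg k t ℓ :=
  ⟨Ev k v, Algebra.subset_adjoin (Or.inl ⟨v, rfl⟩)⟩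

/-- The `j`-th arrow of branch `i` as an element of the path algebra. -/
def arE (i : Fin t) (j : ℕ) : PathAlg k t ℓ :=
  ⟨Ar k i j, Algebra.subset_adjoin (Or.inr ⟨i, j, rfl⟩)⟩

/-- The path along branch `i` from its `a`-th vertex to its `b`-th vertex, as an element
of the path algebra: the product (composed from left to right) of the arrows
`a → a+1 → ⋯ → b`.  (For `b ≤ a` this is the empty product `1`.) -/
def subE (i : Fin t) (a b : ℕ) : PathAlg k t ℓ :=
  (((List.range (b - a)).map fun s => arE i (a + s)).prod)

/-- The `i`-th branch `w i` (the path from the source to the sink along branch `i`)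
as an element of the path algebra. -/
def wE (i : Fin t) : PathAlg k t ℓ := subE i 0 (ℓ i)

variable {k : Type u} [Field k]

/-- A toupie algebra `A = kQ/I`: a toupie quiver `Q` (a non-linear quiver with a unique
source, a unique sink, and all other vertices having exactly one incoming and one
outgoing arrow, i.e. `t ≥ 2` branches of lengths `ℓ i ≥ 1`), together with an admissible
ideal `I` of the path algebra `kQ`.  Since `Q` is finite and acyclic, the arrow ideal is
nilpotent, so admissibility amounts to `I ⊆ R_Q²`, i.e. every element of `I` is a linear
combination of paths of length `≥ 2`. -/
structure ToupieAlg (k : Type u) [Field k] : Type u where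
  t : ℕ
  ht : 2 ≤ t
  ℓ : Fin t → ℕ
  hℓ : ∀ i, 1 ≤ ℓ i
  I : TwoSidedIdeal (PathAlg k t ℓ)
  adm : ∀ x ∈ I, x ∈ Submodule.span k
    {y : PathAlg k t ℓ | ∃ i a b, a + 2 ≤ b ∧ b ≤ ℓ i ∧ y = subE i a b}

variable (T : ToupieAlg k)

/-- The underlying algebra `A = kQ/I` of a toupie algebra. -/
def Alg : Type u := T.I.ringCon.Quotient

instance : Ring (Alg T) := inferInstanceAs (Ring T.I.ringCon.Quotient)

/-- The quotient map `kQ → A = kQ/I`. -/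
def mkA : PathAlg k T.t T.ℓ →+* Alg T := T.I.ringCon.mk'

lemma mkA_surjective : Function.Surjective (mkA T) := Quotient.mk''_surjective

instance : Algebra k (Alg T) :=
  RingHom.toAlgebra' ((mkA T).comp (algebraMap k (PathAlg k T.t T.ℓ)))
    (by
      intro c x
      obtain ⟨y, rfl⟩ := mkA_surjective T x
      simp only [RingHom.coe_comp, Function.comp_apply, ← map_mul]
      rw [Algebra.commutes])

/-- The idempotent `e₀` (at the source) in `A`. -/
def e0 : Alg T := mkA T (eV Vtx.src)

/-- The idempotent `e∞` (at the sink) in `A`. -/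
def einf : Alg T := mkA T (eV Vtx.snk)

/-- The `k`-linear map `A → A`, `x ↦ e₀ * x * e∞`, whose range is `e₀ A e∞`. -/
def lrMap : Alg T →ₗ[k] Alg T where
  toFun x := e0 T * x * einf T
  map_add' x y := by simp [mul_add, add_mul]
  map_smul' c x := by
    simp only [RingHom.id_apply]
    rw [mul_smul_comm, smul_mul_assoc]

/-- `m = dim_k e₀ A e∞`, the dimension of the span of the (residues of the) paths from
the source to the sink. -/
def mDim : ℕ := Module.finrank k ↥(LinearMap.range (lrMap T))

/-- The branch `w i` lies in the ideal `I`. -/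
def branchInI (i : Fin T.t) : Prop := wE i ∈ T.I

/-- A minimal relation: `∑_{i ∈ J} λ i • w i ∈ I` with `|J| ≥ 2`, all `λ i ≠ 0`, and no
nonempty proper subsum in `I`. -/
def MinRel (J : Finset (Fin T.t)) (lam : Fin T.t → k) : Prop :=
  2 ≤ J.card ∧ (∀ i ∈ J, lam i ≠ 0) ∧ (∑ i ∈ J, lam i • wE i) ∈ T.I ∧
    ∀ J' ⊂ J, J'.Nonempty → (∑ i ∈ J', lam i • wE i) ∉ T.I

/-- A toupie algebra is simply connected if any two distinct branches are involved in a
common minimal relation. -/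
def SimplyConnected : Prop :=
  ∀ i j : Fin T.t, i ≠ j → ∃ J lam, MinRel T J lam ∧ i ∈ J ∧ j ∈ J

/-- A (minimal) zero-relation on branch `i`: the subpath of branch `i` from its `a`-th
to its `b`-th vertex lies in `I`, but no proper subpath of it does. -/
def ZeroRel (i : Fin T.t) (a b : ℕ) : Prop :=
  a < b ∧ b ≤ T.ℓ i ∧ subE i a b ∈ T.I ∧
    ∀ a' b', a ≤ a' → b' ≤ b → a' < b' → (a', b') ≠ (a, b) → subE i a' b' ∉ T.I

/-- There is exactly one relation on branch `i`. -/
def ExactlyOneRel (i : Fin T.t) : Prop := ∃! p : ℕ × ℕ, ZeroRel T i p.1 p.2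

/-- Branch `i` carries more than one relation. -/
def MoreThanOneRel (i : Fin T.t) : Prop :=
  ∃ p q : ℕ × ℕ, p ≠ q ∧ ZeroRel T i p.1 p.2 ∧ ZeroRel T i q.1 q.2

/-- At most one branch of `Q` has length at least three. -/
def AtMostOneLongBranch : Prop := ∀ i j : Fin T.t, 3 ≤ T.ℓ i → 3 ≤ T.ℓ j → i = j

/-- The two-sided ideal `I` is generated by the set `S`. -/
def IsGenBy {R : Type u} [Ring R] (I : TwoSidedIdeal R) (S : Set R) : Prop :=
  S ⊆ (I : Set R) ∧ ∀ J : TwoSidedIdeal R, S ⊆ (J : Set R) → (I : Set R) ⊆ (J : Set R)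

/-- A toupie algebra is canonical if (after choosing two distinguished branches `i₁, i₂`)
its ideal is generated by `{w i₁ + λ j • w i₂ - w j}` over the remaining branches `j`,
with the `λ j` pairwise distinct and nonzero. -/
def IsCanonical : Prop :=
  ∃ (i₁ i₂ : Fin T.t) (lam : Fin T.t → k), i₁ ≠ i₂ ∧
    (∀ j, j ≠ i₁ → j ≠ i₂ → lam j ≠ 0) ∧
    (∀ j j', j ≠ i₁ → j ≠ i₂ → j' ≠ i₁ → j' ≠ i₂ → j ≠ j' → lam j ≠ lam j') ∧
    IsGenBy T.I {x | ∃ j, j ≠ i₁ ∧ j ≠ i₂ ∧ x = wE i₁ + lam j • wE i₂ - wE j}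

end Toupie
namespace Toupie

/-! ### Module-theoretic notions over an arbitrary ring

Following the paper, all modules are finite-dimensional *right* modules; a right
`A`-module is formalized as a (left) module over `Aᵐᵒᵖ`.  The definitions below are
stated for modules over an arbitrary ring `R` and are applied with `R := Aᵐᵒᵖ`. -/

variable (R : Type u) [Ring R]

/-- A module is indecomposable if it is nonzero and its only idempotent endomorphisms
are `0` and the identity. -/
def Indec (M : ModuleCat.{u} R) : Prop :=
  Nontrivial M ∧ ∀ f : M →ₗ[R] M, f.comp f = f → f = 0 ∨ f = LinearMap.id

/-- Finiteness ("finite dimensionality") of a module. -/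
def FdMod (M : ModuleCat.{u} R) : Prop := Module.Finite R M

/-- `M` has projective dimension at most one: it is the quotient of a projective module
by a projective submodule. -/
def PdLeOne (M : ModuleCat.{u} R) : Prop :=
  ∃ (P : ModuleCat.{u} R) (f : P →ₗ[R] M), Function.Surjective f ∧
    Module.Projective R P ∧ Module.Projective R ↥(LinearMap.ker f)

/-- `M` has injective dimension at most one: it embeds in an injective module with
injective cokernel. -/
def IdLeOne (M : ModuleCat.{u} R) : Prop :=
  ∃ (E : ModuleCat.{u} R) (f : M →ₗ[R] E), Function.Injective f ∧
    Module.Injective R E ∧ Module.Injective R (E ⧸ LinearMap.range f)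

/-- One step of a path in `ind R`: a nonzero non-isomorphism between (finite-dimensional)
indecomposable modules. -/
def Step (M N : ModuleCat.{u} R) : Prop :=
  Indec R M ∧ FdMod R M ∧ Indec R N ∧ FdMod R N ∧
    ∃ f : M →ₗ[R] N, f ≠ 0 ∧ ¬ Function.Bijective f

/-- A path in `ind R` from `M` to `N` (possibly trivial): a chain
`M = M₀ → M₁ → ⋯ → Mₙ = N` of nonzero non-isomorphisms between indecomposables. -/
def IndPath (M N : ModuleCat.{u} R) : Prop := Relation.ReflTransGen (Step R) M N

/-- The left part `L_R`: the indecomposable (finite-dimensional) modules `M` such that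
every indecomposable `X` with a path `X ⇝ M` in `ind R` has projective dimension `≤ 1`. -/
def InLeftPart (M : ModuleCat.{u} R) : Prop :=
  Indec R M ∧ FdMod R M ∧
    ∀ X : ModuleCat.{u} R, Indec R X → FdMod R X → IndPath R X M → PdLeOne R X

/-- The right part `R_R`: the indecomposable (finite-dimensional) modules `M` such that
every indecomposable `X` with a path `M ⇝ X` in `ind R` has injective dimension `≤ 1`. -/
def InRightPart (M : ModuleCat.{u} R) : Prop :=
  Indec R M ∧ FdMod R M ∧
    ∀ X : ModuleCat.{u} R, Indec R X → FdMod R X → IndPath R M X → IdLeOne R X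

/-- Hereditary: global dimension at most one, i.e. every module has projective dimension
at most one. -/
def Hereditary : Prop := ∀ M : ModuleCat.{u} R, PdLeOne R M

/-- Quasitilted: every indecomposable projective module lies in the left part. -/
def Quasitilted : Prop :=
  ∀ P : ModuleCat.{u} R, Indec R P → FdMod R P → Module.Projective R P → InLeftPart R P

/-- A module is directed if it lies on no cycle of nonzero non-isomorphisms between
indecomposables in `ind R`. -/
def Directed (M : ModuleCat.{u} R) : Prop := ¬ Relation.TransGen (Step R) M M

/-- Weakly shod: every indecomposable (finite-dimensional) module not lying in
`L_R ∪ R_R` is directed. -/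
def WeaklyShod : Prop :=
  ∀ M : ModuleCat.{u} R, Indec R M → FdMod R M →
    ¬ InLeftPart R M → ¬ InRightPart R M → Directed R M

/-- Laura: all but finitely many isomorphism classes of indecomposable
(finite-dimensional) modules lie in `L_R ∪ R_R`. -/
def Laura : Prop :=
  ∃ S : Set (ModuleCat.{u} R), S.Finite ∧
    ∀ M : ModuleCat.{u} R, Indec R M → FdMod R M →
      ¬ InLeftPart R M → ¬ InRightPart R M → ∃ N ∈ S, Nonempty (M ≃ₗ[R] N)

/-- There are exactly `n` isomorphism classes of modules satisfying `P`. -/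
def NumClasses (P : ModuleCat.{u} R → Prop) (n : ℕ) : Prop :=
  ∃ f : Fin n → ModuleCat.{u} R, (∀ i, P (f i)) ∧
    (∀ i j, Nonempty ((f i : Type u) ≃ₗ[R] (f j : Type u)) → i = j) ∧
    ∀ M : ModuleCat.{u} R, P M → ∃ i, Nonempty ((M : Type u) ≃ₗ[R] (f i : Type u))

/-- `M` is (isomorphic to) a direct summand of `T`. -/
def IsSummandOf (T : Type u) [AddCommGroup T] [Module R T] (M : ModuleCat.{u} R) : Prop :=
  ∃ N N' : Submodule R T, IsCompl N N' ∧ Nonempty ((M : Type u) ≃ₗ[R] N)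

/-- `Ext¹_R(T, T) = 0`: every self-extension `0 → T → E → T → 0` splits. -/
def SelfExtVanish (T : Type u) [AddCommGroup T] [Module R T] : Prop :=
  ∀ (E : Type u) [AddCommGroup E] [Module R E] (ι : T →ₗ[R] E) (π : E →ₗ[R] T),
    Function.Injective ι → Function.Surjective π → LinearMap.range ι = LinearMap.ker π →
      ∃ s : T →ₗ[R] E, π.comp s = LinearMap.id

/-- A tilting module over a hereditary algebra: a finite module with `Ext¹(T,T) = 0`
having as many pairwise non-isomorphic indecomposable direct summands as there are
simple modules. -/
def IsTiltingMod (T : Type u) [AddCommGroup T] [Module R T] : Prop :=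
  Module.Finite R T ∧ SelfExtVanish R T ∧
    ∃ n : ℕ, NumClasses R (fun M => Indec R M ∧ IsSummandOf R T M) n ∧
      NumClasses R (fun M => IsSimpleModule R M) n

variable (k : Type u) [Field k]

/-- A `k`-algebra `A` is tilted if it is the endomorphism algebra of a tilting (right)
module over a hereditary finite-dimensional `k`-algebra `H`.  (Right `H`-modules are
modules over `Hᵐᵒᵖ`; the isomorphism `A ≅ End_H T` is a `k`-linear ring isomorphism.) -/
def IsTilted (A : Type u) [Ring A] [Algebra k A] : Prop :=
  ∃ (H : Type u) (_ : Ring H) (_ : Algebra k H),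
    FiniteDimensional k H ∧ Hereditary Hᵐᵒᵖ ∧
      ∃ (T : Type u) (_ : AddCommGroup T) (_ : Module Hᵐᵒᵖ T),
        IsTiltingMod Hᵐᵒᵖ T ∧
          ∃ (_ : Module k T) (_ : SMulCommClass Hᵐᵒᵖ k T) (_ : IsScalarTower k Hᵐᵒᵖ T)
            (φ : A ≃+* Module.End Hᵐᵒᵖ T), ∀ (c : k) (x : A), φ (c • x) = c • φ x

end Toupie
namespace Toupie

variable {k : Type u} [Field k] (T : ToupieAlg k)

/-! ### Right `A`-modules as representations of `(Q, I)`

For a right `A`-module `M` (a module over `Aᵐᵒᵖ`) and a vertex `v`, the space of the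
corresponding representation at `v` is `M_v = M • e_v`. -/

/-- The action of the idempotent `e_v ∈ A` on a right `A`-module (= `Aᵐᵒᵖ`-module). -/
def actV (v : Vtx T.t T.ℓ) : (Alg T)ᵐᵒᵖ := op (mkA T (eV v))

/-- The space `M_v = M • e_v` of the representation `M` at the vertex `v` is zero. -/
def VanishAt (M : ModuleCat.{u} (Alg T)ᵐᵒᵖ) (v : Vtx T.t T.ℓ) : Prop :=
  ∀ m : M, actV T v • m = 0

/-- Every simple summand of `top M = M / rad M` is one of the simple modules `S_v`,
`v ∈ vs`: for every maximal submodule `N` the simple quotient `M/N` is supported at some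
vertex of `vs` (for an admissible quotient of a path algebra, the simple module `S_v` is
the unique simple on which `e_v` acts nontrivially). -/
def TopIn (M : ModuleCat.{u} (Alg T)ᵐᵒᵖ) (vs : Set (Vtx T.t T.ℓ)) : Prop :=
  ∀ N : Submodule (Alg T)ᵐᵒᵖ M, IsCoatom N → ∃ v ∈ vs, ∃ m : M, actV T v • m ∉ N

/-- Every simple summand of the socle of `M` is one of the simple modules `S_v`,
`v ∈ vs`: every simple submodule `N ≤ M` is supported at some vertex of `vs`. -/
def SocIn (M : ModuleCat.{u} (Alg T)ᵐᵒᵖ) (vs : Set (Vtx T.t T.ℓ)) : Prop :=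
  ∀ N : Submodule (Alg T)ᵐᵒᵖ M, IsAtom N → ∃ v ∈ vs, ∃ m ∈ N, actV T v • m ≠ 0

/-- The module `D x y` (for two positions `0 ≤ x, y ≤ ℓ i₀` on the unique branch `i₀`
lying in `I`, and an auxiliary branch `i₂ ≠ i₀`): the right `A`-module with generators
`g = e₀` (at the source) and `h = e_y` (at the `y`-th vertex of branch `i₀`), subject to
the relations `g ⬝ (subpath of w i₀ from 0 to x+1) = 0` and
`g ⬝ w i₂ = h ⬝ (subpath of w i₀ from y to ℓ i₀)`.  It is presented as the quotient of
the right regular module `A ⊕ A` by the right submodule generated by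
`(1 - e₀, 0)`, `(0, 1 - e_y)`, `(subE i₀ 0 (min (x+1) (ℓ i₀)), 0)` and
`(w i₂, - subE i₀ y (ℓ i₀))`. -/
abbrev Dmod (i₀ i₂ : Fin T.t) (x y : ℕ) : Type u :=
  (Alg T × Alg T) ⧸ Submodule.span (Alg T)ᵐᵒᵖ
    ({((mkA T (1 - eV Vtx.src) : Alg T), (0 : Alg T)),
      ((0 : Alg T), (mkA T (1 - eV (vtx T.t T.ℓ i₀ y)) : Alg T)),
      ((mkA T (subE i₀ 0 (min (x + 1) (T.ℓ i₀))) : Alg T), (0 : Alg T)),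
      ((mkA T (wE i₂) : Alg T), (- mkA T (subE i₀ y (T.ℓ i₀)) : Alg T))} :
        Set (Alg T × Alg T))

end Toupie

namespace Toupie

section Homological

variable {R : Type u} [Ring R]

lemma exists_smul_eq_of_injective {E : Type u} [AddCommGroup E] [Module R E]
    (hE : Module.Injective R E) {β : R} {y : E} (h : ∀ r : R, r * β = 0 → r • y = 0) :
    ∃ x : E, β • x = y := by
  let p := LinearMap.toSpanSingleton R R β
  have hk : LinearMap.ker p ≤ LinearMap.ker (LinearMap.toSpanSingleton R E y) := by
    intro r hr
    exact h r hr
  obtain ⟨g, hg⟩ := hE.out ((LinearMap.ker p).liftQ p le_rfl)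
    (LinearMap.ker_eq_bot.1 (Submodule.ker_liftQ_eq_bot _ _ _ le_rfl))
    ((LinearMap.ker p).liftQ _ hk)
  refine ⟨g 1, ?_⟩
  have := hg (Submodule.Quotient.mk 1)
  simp only [Submodule.liftQ_apply, p, LinearMap.toSpanSingleton_apply, one_smul] at this
  rw [← map_smul, smul_eq_mul, mul_one, this]

lemma smul_eq_zero_of_projective {P : Type u} [AddCommGroup P] [Module R P]
    (hP : Module.Projective R P) {α e : R} (h : ∀ x : R, α * x = 0 → e * x = 0) {y : P}
    (hy : α • y = 0) : e • y = 0 := by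
  obtain ⟨s, hs⟩ := hP.out
  apply hs.injective
  ext p
  have := DFunLike.congr_fun (congrArg s hy) p
  simp only [map_smul, map_zero, Finsupp.smul_apply, Finsupp.zero_apply, smul_eq_mul] at this ⊢
  exact h _ this

lemma exists_eq_smul_of_projective {P : Type u} [AddCommGroup P] [Module R P]
    (hP : Module.Projective R P) {α e q : R}
    (h : ∀ x : R, q * x = 0 → ∃ x', e * x = α * x') {y : P}
    (hy : q • y = 0) : ∃ z : P, e • y = α • z := by
  obtain ⟨s, hs⟩ := hP.out
  have hc : ∀ p, q * s y p = 0 := by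
    intro p
    have := DFunLike.congr_fun (congrArg s hy) p
    simpa using this
  choose g hg using fun p => h _ (hc p)
  refine ⟨∑ p ∈ (s y).support, g p • p, ?_⟩
  conv_lhs => rw [← hs y]
  rw [Finsupp.linearCombination_apply, Finsupp.sum, Finset.smul_sum, Finset.smul_sum]
  refine Finset.sum_congr rfl fun p _ => ?_
  rw [id, smul_smul, hg, smul_smul]

lemma not_pdLeOne (M : ModuleCat.{u} R) {α e e' q : R}
    (h1 : ∀ x : R, α * x = 0 → e * x = 0) (h2 : ∀ x : R, q * x = 0 → ∃ x', e' * x = α * x')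
    (hqα : q * α = 0) (heα : e' * α = α) {w : M} (hw : e • w = w) (hw0 : w ≠ 0)
    (hαw : α • w = 0) : ¬ PdLeOne R M := by
  rintro ⟨P, f, hf, hP, hK⟩
  obtain ⟨y, rfl⟩ := hf w
  let z : LinearMap.ker f := ⟨α • y, by rw [LinearMap.mem_ker, map_smul, hαw]⟩
  obtain ⟨z', hz'⟩ := exists_eq_smul_of_projective hK h2 (y := z) (by
    ext; simp [z, smul_smul, hqα])
  have hz : e' • α • y = α • (z' : P) := congrArg Subtype.val hz'
  rw [smul_smul, heα] at hz
  have h0 : e • (y - (z' : P)) = 0 :=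
    smul_eq_zero_of_projective hP h1 (by rw [smul_sub, hz, sub_self])
  have := congrArg f h0
  rw [map_smul, map_sub, LinearMap.mem_ker.1 z'.2, sub_zero, hw, map_zero] at this
  exact hw0 this

lemma not_idLeOne (M : ModuleCat.{u} R) {β e e' q : R}
    (h1 : ∀ r : R, r * β = 0 → r * e = 0) (h2 : ∀ r : R, r * q = 0 → ∃ s, r * e' = s * β)
    (hβq : β * q = 0) (hβe : β * e' = β) {w : M} (hw : e • w = w)
    (hβw : ∀ m : M, β • m ≠ w) : ¬ IdLeOne R M := by
  rintro ⟨E, f, hf, hE, hC⟩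
  obtain ⟨y, hy⟩ := exists_smul_eq_of_injective hE (β := β) (y := f w) (by
    intro r hr
    rw [← hw, ← map_smul, smul_smul, h1 r hr, zero_smul, map_zero])
  obtain ⟨x, hx⟩ := exists_smul_eq_of_injective hC (β := q)
    (y := (LinearMap.range f).mkQ (e' • y)) (by
    intro r hr
    obtain ⟨s, hs⟩ := h2 r hr
    rw [← map_smul, smul_smul, hs, mul_smul, hy, ← map_smul, Submodule.mkQ_apply,
      Submodule.Quotient.mk_eq_zero]
    exact LinearMap.mem_range_self _ _)
  obtain ⟨x, rfl⟩ := Submodule.mkQ_surjective _ x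
  rw [← map_smul, ← sub_eq_zero, ← map_sub, Submodule.mkQ_apply,
    Submodule.Quotient.mk_eq_zero] at hx
  obtain ⟨m, hm⟩ := hx
  apply hβw (-m)
  apply hf
  rw [map_smul, map_neg, hm, neg_sub, smul_sub, smul_smul, hβe, smul_smul, hβq, zero_smul,
    sub_zero, hy]

end Homological

end Toupie

namespace Toupie

section PathSystem

variable {k : Type u} [Field k] {t : ℕ} {ℓ : Fin t → ℕ}

instance : Finite (Vtx t ℓ) :=
  Finite.of_surjective
    (fun o : Option (Option (Σ i : Fin t, Fin (ℓ i - 1))) => match o with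
      | none => Vtx.src
      | some none => Vtx.snk
      | some (some p) => Vtx.mid p.1 p.2)
    (by rintro (_ | _ | ⟨i, a⟩)
        exacts [⟨none, rfl⟩, ⟨some none, rfl⟩, ⟨some (some ⟨i, a⟩), rfl⟩])

instance : Fintype (Vtx t ℓ) := Fintype.ofFinite _

instance : Finite (PIdx t ℓ) := by
  refine Finite.of_injective
    (β := Vtx t ℓ ⊕ (Σ i : Fin t, Fin (ℓ i + 1) × Fin (ℓ i + 1)))
    (fun p => match p with
      | .vert v => Sum.inl v
      | .sub i a b hab hb => Sum.inr ⟨i, ⟨a, by omega⟩, ⟨b, by omega⟩⟩) ?_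
  rintro (v | ⟨i, a, b, hab, hb⟩) (w | ⟨j, c, d, hcd, hd⟩) h
  · simpa using h
  · simp at h
  · simp at h
  · simp only [Sum.inr.injEq, Sigma.mk.injEq] at h
    obtain ⟨rfl, h⟩ := h
    simpa using h

instance : Fintype (PIdx t ℓ) := Fintype.ofFinite _

/-- The final vertex of a path. -/
def endIdx : PIdx t ℓ → Vtx t ℓ
  | .vert v => v
  | .sub i _ b _ _ => vtx t ℓ i b

lemma strip_eq_some {i : Fin t} {j : ℕ} {p q : PIdx t ℓ} (h : strip i j p = some q) :
    ∃ (b : ℕ) (hjb : j < b) (hb : b ≤ ℓ i), p = .sub i j b hjb hb ∧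
      ((b = j + 1 ∧ q = .vert (vtx t ℓ i b)) ∨ ∃ hb' : j + 1 < b, q = .sub i (j + 1) b hb' hb) := by
  rcases p with v | ⟨i', a, b, hab, hb⟩
  · simp [strip] at h
  · simp only [strip] at h
    split at h
    · obtain ⟨rfl, rfl⟩ := ‹_ ∧ _›
      refine ⟨b, hab, hb, rfl, ?_⟩
      split at h
      · exact Or.inr ⟨‹_›, (Option.some.inj h).symm⟩
      · exact Or.inl ⟨by omega, (Option.some.inj h).symm⟩
    · simp at h

lemma strip_injective {i : Fin t} {j : ℕ} {p p' q : PIdx t ℓ} (h : strip i j p = some q)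
    (h' : strip i j p' = some q) : p = p' := by
  obtain ⟨b, hjb, hb, rfl, hq⟩ := strip_eq_some h
  obtain ⟨b', hjb', hb', rfl, hq'⟩ := strip_eq_some h'
  suffices b = b' by subst this; rfl
  rcases hq with ⟨rfl, rfl⟩ | ⟨_, rfl⟩ <;> rcases hq' with ⟨rfl, hq'⟩ | ⟨_, hq'⟩
  · rfl
  · simp at hq'
  · simp at hq'
  · simpa using hq'

section Seg

variable {C : Type*} [Monoid C]

/-- The product `A a * A (a + 1) * ⋯ * A (b - 1)`. -/
def seg (A : ℕ → C) (a b : ℕ) : C := ((List.range (b - a)).map fun s => A (a + s)).prod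

lemma seg_self (A : ℕ → C) (a : ℕ) : seg A a a = 1 := by simp [seg]

lemma seg_succ (A : ℕ → C) {a b : ℕ} (h : a ≤ b) : seg A a (b + 1) = seg A a b * A b := by
  simp [seg, Nat.succ_sub h, List.range_succ, Nat.add_sub_cancel' h]

lemma seg_mul (A : ℕ → C) {a b c : ℕ} (hab : a ≤ b) (hbc : b ≤ c) :
    seg A a b * seg A b c = seg A a c := by
  induction c, hbc using Nat.le_induction with
  | base => simp [seg_self]
  | succ c hbc ih => rw [seg_succ A hbc, seg_succ A (hab.trans hbc), ← mul_assoc, ih]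

lemma seg_one (A : ℕ → C) (a : ℕ) : seg A a (a + 1) = A a := by
  rw [seg_succ A le_rfl, seg_self, one_mul]

lemma mul_seg (A : ℕ → C) {a b : ℕ} (h : a < b) : A a * seg A (a + 1) b = seg A a b := by
  rw [← seg_one A a, seg_mul A (Nat.le_succ a) h]

lemma subE_eq_seg (i : Fin t) (a b : ℕ) :
    (subE i a b : PathAlg k t ℓ) = seg (arE i) a b := rfl

lemma map_seg {D F : Type*} [Monoid D] [FunLike F C D] [MonoidHomClass F C D] (f : F) (A : ℕ → C)
    (a b : ℕ) : f (seg A a b) = seg (fun j => f (A j)) a b := by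
  simp [seg, map_list_prod, Function.comp_def]

end Seg

variable {C : Type*} [Ring C]

/-- The relations between the vertices and the arrows of the toupie quiver in its path algebra. -/
structure IsPathSystem (E : Vtx t ℓ → C) (A : Fin t → ℕ → C) : Prop where
  idem : ∀ v w, E v * E w = if v = w then E v else 0
  sum_one : ∑ v, E v = 1
  left : ∀ i j, j < ℓ i → E (vtx t ℓ i j) * A i j = A i j
  right : ∀ i j, j < ℓ i → A i j * E (vtx t ℓ i (j + 1)) = A i j
  zero : ∀ i j, ℓ i ≤ j → A i j = 0

/-- The value of a path under an assignment of values to vertices and arrows. -/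
def pathC (E : Vtx t ℓ → C) (A : Fin t → ℕ → C) : PIdx t ℓ → C
  | .vert v => E v
  | .sub i a b _ _ => seg (A i) a b

namespace IsPathSystem

variable {E : Vtx t ℓ → C} {A : Fin t → ℕ → C} (h : IsPathSystem E A)

include h

lemma start_mul (p : PIdx t ℓ) : E (startIdx p) * pathC E A p = pathC E A p := by
  rcases p with v | ⟨i, a, b, hab, hb⟩
  · simp [pathC, startIdx, h.idem]
  · simp only [pathC, startIdx]
    rw [← mul_seg _ hab, ← mul_assoc, h.left i a (by omega)]

lemma mul_end (p : PIdx t ℓ) : pathC E A p * E (endIdx p) = pathC E A p := by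
  rcases p with v | ⟨i, a, b, hab, hb⟩
  · simp [pathC, endIdx, h.idem]
  · simp only [pathC, endIdx]
    obtain ⟨b, rfl⟩ : ∃ c, b = c + 1 := ⟨b - 1, by omega⟩
    rw [seg_succ _ (by omega), mul_assoc, h.right i b (by omega)]

lemma vert_mul (v : Vtx t ℓ) (p : PIdx t ℓ) :
    E v * pathC E A p = if startIdx p = v then pathC E A p else 0 := by
  rw [← h.start_mul p, ← mul_assoc, h.idem]
  by_cases hv : startIdx p = v
  · subst hv; simp
  · simp [hv, Ne.symm hv]

lemma mul_vert (v : Vtx t ℓ) (p : PIdx t ℓ) :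
    pathC E A p * E v = if endIdx p = v then pathC E A p else 0 := by
  rw [← h.mul_end p, mul_assoc, h.idem]
  by_cases hv : endIdx p = v <;> simp [hv]

lemma arrow_mul (i : Fin t) (j : ℕ) (q : PIdx t ℓ) :
    A i j * pathC E A q = ∑ p, if strip i j p = some q then pathC E A p else 0 := by
  by_cases hex : ∃ p, strip i j p = some q
  · obtain ⟨p, hp⟩ := hex
    rw [Finset.sum_eq_single p, if_pos hp]
    · obtain ⟨b, hjb, hb, rfl, ⟨rfl, rfl⟩ | ⟨hb', rfl⟩⟩ := strip_eq_some hp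
      · simp only [pathC]
        rw [h.right i j hb, seg_one]
      · simp only [pathC]
        rw [mul_seg _ hjb]
    · intro p' _ hne
      exact if_neg fun hp' => hne (strip_injective hp' hp)
    · simp
  · rw [Finset.sum_eq_zero fun p _ => if_neg fun hp => hex ⟨p, hp⟩]
    by_cases hj : ℓ i ≤ j
    · rw [h.zero i j hj, zero_mul]
    push Not at hj
    rw [← h.right i j hj, mul_assoc, h.vert_mul, if_neg, mul_zero]
    intro hs
    apply hex
    rcases q with v | ⟨i', a, b, hab, hb⟩
    · obtain rfl : v = _ := hs
      exact ⟨.sub i j (j + 1) (by omega) hj, by simp [strip]⟩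
    · have hs : vtx t ℓ i' a = vtx t ℓ i (j + 1) := hs
      rw [vtx, vtx, if_neg (Nat.succ_ne_zero j)] at hs
      split_ifs at hs with h1 h2 h3 <;> try omega
      obtain ⟨rfl, hs⟩ := Vtx.mid.inj hs
      have := congrArg Fin.val (eq_of_heq hs)
      simp only at this
      obtain rfl : a = j + 1 := by omega
      exact ⟨.sub i' j b (by omega) hb, by simp [strip, hab]⟩

variable [Algebra k C]

omit h in
/-- The linear extension of an assignment of values to paths. -/
def lin (k : Type u) [Field k] [Algebra k C] (E : Vtx t ℓ → C) (A : Fin t → ℕ → C) :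
    PSp k t ℓ →ₗ[k] C :=
  Fintype.linearCombination k (pathC E A)

lemma lin_Ev (v : Vtx t ℓ) (f : PSp k t ℓ) :
    lin k E A (Ev k v f) = E v * lin k E A f := by
  simp only [lin, Fintype.linearCombination_apply, Finset.mul_sum, mul_smul_comm, h.vert_mul]
  refine Finset.sum_congr rfl fun p _ => ?_
  by_cases hp : startIdx p = v <;> simp [Ev, hp]

lemma lin_Ar (i : Fin t) (j : ℕ) (f : PSp k t ℓ) :
    lin k E A (Ar k i j f) = A i j * lin k E A f := by
  simp only [lin, Fintype.linearCombination_apply, Finset.mul_sum, mul_smul_comm, h.arrow_mul,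
    Finset.smul_sum]
  rw [Finset.sum_comm]
  refine Finset.sum_congr rfl fun p _ => ?_
  rcases hp : strip i j p with _ | q
  · simp [Ar, hp]
  · simp [Ar, hp]

omit h in
/-- The coefficients of the unit of the path algebra. -/
def unitVec (k : Type u) [Field k] : PSp k t ℓ
  | .vert _ => 1
  | .sub _ _ _ _ _ => 0

lemma lin_unitVec : lin k E A (unitVec k) = 1 := by
  rw [lin, Fintype.linearCombination_apply, ← h.sum_one]
  symm
  refine Finset.sum_bij_ne_zero (fun v _ _ => .vert v) (by simp) ?_ ?_ ?_
  · rintro v _ _ w _ _ hvw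
    simpa using hvw
  · rintro (v | ⟨i, a, b, hab, hb⟩) _ hp
    · exact ⟨v, by simp, by simpa [unitVec, pathC] using hp, rfl⟩
    · simp [unitVec] at hp
  · intro v _ _
    simp [unitVec, pathC]

lemma lin_apply_mul (x : PathAlg k t ℓ) (f : PSp k t ℓ) :
    lin k E A (x.1 f) = lin k E A (x.1 (unitVec k)) * lin k E A f := by
  obtain ⟨x, hx⟩ := x
  induction hx using Algebra.adjoin_induction generalizing f with
  | mem x hx =>
    rcases hx with ⟨v, rfl⟩ | ⟨i, j, rfl⟩
    · simp only [h.lin_Ev, h.lin_unitVec, mul_one]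
    · simp only [h.lin_Ar, h.lin_unitVec, mul_one]
  | algebraMap r =>
    simp [Module.algebraMap_end_apply, h.lin_unitVec]
  | add x y hx hy ihx ihy =>
    simp only [LinearMap.add_apply, map_add, add_mul] at *
    rw [ihx, ihy]
  | mul x y hx hy ihx ihy =>
    simp only [Module.End.mul_apply] at *
    rw [ihx, ihy, ihx (y (unitVec k)), mul_assoc]

/-- The universal property of the path algebra of the toupie quiver. -/
def lift : PathAlg k t ℓ →ₐ[k] C :=
  AlgHom.ofLinearMap
    ((lin k E A).comp ((LinearMap.applyₗ (unitVec k)).comp (PathAlg k t ℓ).val.toLinearMap))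
    (by simp [h.lin_unitVec])
    (fun x y => by
      have := h.lin_apply_mul x (y.1 (unitVec k))
      simpa using this)

lemma lift_apply (x : PathAlg k t ℓ) :
    h.lift x = ∑ p, x.1 (unitVec k) p • pathC E A p := rfl

lemma lift_eV (v : Vtx t ℓ) : h.lift (eV v : PathAlg k t ℓ) = E v := by
  change lin k E A (Ev k v (unitVec k)) = _
  rw [h.lin_Ev, h.lin_unitVec, mul_one]

lemma lift_arE (i : Fin t) (j : ℕ) : h.lift (arE i j : PathAlg k t ℓ) = A i j := by
  change lin k E A (Ar k i j (unitVec k)) = _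
  rw [h.lin_Ar, h.lin_unitVec, mul_one]

lemma lift_subE (i : Fin t) (a b : ℕ) :
    h.lift (subE i a b : PathAlg k t ℓ) = seg (A i) a b := by
  rw [subE_eq_seg]
  refine (map_seg h.lift _ a b).trans ?_
  congr 1
  funext j
  exact h.lift_arE i j

end IsPathSystem

variable (k t ℓ) in
/-- The path algebra, with its vertices and arrows. -/
lemma isPathSystem : IsPathSystem (eV (k := k) (t := t) (ℓ := ℓ)) arE where
  idem v w := by
    apply Subtype.ext
    refine LinearMap.ext fun f => funext fun p => ?_
    split_ifs with h
    · subst h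
      by_cases hp : startIdx p = v <;> simp [eV, Ev, hp]
    · by_cases hp : startIdx p = v
      · subst hp; simp [eV, Ev, h]
      · simp [eV, Ev, hp]
  sum_one := by
    ext f p
    simp [eV, Ev]
  left i j hj := by
    ext f p
    rcases hp : strip i j p with _ | q
    · simp [eV, arE, Ar, Ev, hp]
    · obtain ⟨b, hjb, hb, rfl, _⟩ := strip_eq_some hp
      simp [eV, arE, Ar, Ev, startIdx]
  right i j hj := by
    ext f p
    rcases hp : strip i j p with _ | q
    · simp [eV, arE, Ar, hp]
    · obtain ⟨b, hjb, hb, rfl, ⟨rfl, rfl⟩ | ⟨hb', rfl⟩⟩ := strip_eq_some hp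
      · simp [eV, arE, Ar, Ev, startIdx, hp]
      · simp [eV, arE, Ar, Ev, startIdx, hp]
  zero i j hj := by
    ext f p
    rcases hp : strip i j p with _ | q
    · simp [arE, Ar, hp]
    · obtain ⟨b, hjb, hb, rfl, _⟩ := strip_eq_some hp
      omega

/-- A path as an element of the path algebra. -/
abbrev pathE (p : PIdx t ℓ) : PathAlg k t ℓ := pathC eV arE p

lemma pathAlg_hom_ext {C : Type*} [Ring C] [Algebra k C] {f g : PathAlg k t ℓ →ₐ[k] C}
    (hv : ∀ v, f (eV v) = g (eV v)) (ha : ∀ i j, f (arE i j) = g (arE i j)) : f = g := by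
  apply AlgHom.adjoin_ext
  rintro x (⟨v, rfl⟩ | ⟨i, j, rfl⟩)
  exacts [hv v, ha i j]

lemma eq_sum_pathE (x : PathAlg k t ℓ) :
    x = ∑ p, x.1 (IsPathSystem.unitVec k) p • pathE p := by
  rw [← (isPathSystem k t ℓ).lift_apply x]
  have : (isPathSystem k t ℓ).lift (k := k) = AlgHom.id k (PathAlg k t ℓ) :=
    pathAlg_hom_ext (C := PathAlg k t ℓ) (fun v => (isPathSystem k t ℓ).lift_eV v)
      fun i j => (isPathSystem k t ℓ).lift_arE i j
  rw [this]; rfl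

end PathSystem

end Toupie

namespace Toupie

section Paths

variable {k : Type u} [Field k] {t : ℕ} {ℓ : Fin t → ℕ}

lemma vtx_zero (i : Fin t) : vtx t ℓ i 0 = .src := by simp [vtx]

lemma vtx_self {i : Fin t} (h : 1 ≤ ℓ i) : vtx t ℓ i (ℓ i) = .snk := by
  rw [vtx, if_neg (by omega), dif_neg (by omega)]

lemma vtx_eq {i i' : Fin t} {a b : ℕ} (ha : a ≤ ℓ i) (hb : b ≤ ℓ i')
    (h : vtx t ℓ i a = vtx t ℓ i' b) :
    (i = i' ∧ a = b) ∨ (a = 0 ∧ b = 0) ∨ (a = ℓ i ∧ b = ℓ i') := by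
  rw [vtx, vtx] at h
  split_ifs at h with h1 h2 h3 h4 <;> try omega
  obtain ⟨rfl, h⟩ := Vtx.mid.inj h
  have := congrArg Fin.val (eq_of_heq h)
  simp only at this
  omega

lemma exists_eq_vtx (i₀ : Fin t) (hℓ : ∀ i, 1 ≤ ℓ i) (v : Vtx t ℓ) :
    ∃ i a, a ≤ ℓ i ∧ v = vtx t ℓ i a := by
  rcases v with _ | _ | ⟨i, a⟩
  · exact ⟨i₀, 0, by omega, (vtx_zero i₀).symm⟩
  · exact ⟨i₀, ℓ i₀, le_rfl, (vtx_self (hℓ i₀)).symm⟩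
  · exact ⟨i, a + 1, by omega, by simp [vtx]⟩

lemma pathE_eq {i : Fin t} {a b : ℕ} (hab : a ≤ b) (hb : b ≤ ℓ i)
    (h : ¬ (a = 0 ∧ b = ℓ i)) {p : PIdx t ℓ} (hs : startIdx p = vtx t ℓ i a)
    (he : endIdx p = vtx t ℓ i b) :
    (pathE p : PathAlg k t ℓ) = eV (vtx t ℓ i a) * subE i a b := by
  rw [← hs, subE_eq_seg]
  rcases p with v | ⟨i', c, d, hcd, hd⟩
  · simp only [startIdx, endIdx] at hs he
    subst hs
    obtain rfl : a = b := by
      rcases vtx_eq (hab.trans hb) hb he with h | h | h <;> omega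
    simp [seg_self, pathC, startIdx]
  · simp only [startIdx, endIdx] at hs he
    obtain ⟨rfl, rfl, rfl⟩ : i' = i ∧ c = a ∧ d = b := by
      rcases vtx_eq hd hb he with ⟨rfl, rfl⟩ | h2 | h2
      · refine ⟨rfl, ?_, rfl⟩
        rcases vtx_eq (hcd.le.trans hd) (hab.trans hb) hs with h1 | h1 | h1 <;> omega
      · omega
      · rcases vtx_eq (hcd.le.trans hd) (hab.trans hb) hs with ⟨rfl, rfl⟩ | h1 | h1
        · exact ⟨rfl, rfl, by omega⟩
        all_goals omega
    exact ((isPathSystem k t ℓ).start_mul (.sub i' c d hcd hd)).symm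

lemma corner_mem (u v : Vtx t ℓ) (x : PathAlg k t ℓ) (S : Submodule k (PathAlg k t ℓ))
    (h : ∀ p, startIdx p = u → endIdx p = v → pathE p ∈ S) : eV u * x * eV v ∈ S := by
  rw [eq_sum_pathE x, Finset.mul_sum, Finset.sum_mul]
  refine S.sum_mem fun p _ => ?_
  rw [mul_smul_comm, smul_mul_assoc]
  apply S.smul_mem
  rw [(isPathSystem k t ℓ).vert_mul]
  split_ifs with h1
  · rw [(isPathSystem k t ℓ).mul_vert]
    split_ifs with h2
    · exact h p h1 h2
    · exact S.zero_mem
  · rw [zero_mul]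
    exact S.zero_mem

lemma exists_corner_eq_smul {i : Fin t} {a b : ℕ} (hab : a ≤ b) (hb : b ≤ ℓ i)
    (h : ¬ (a = 0 ∧ b = ℓ i)) (x : PathAlg k t ℓ) :
    ∃ c : k, eV (vtx t ℓ i a) * x * eV (vtx t ℓ i b) = c • (eV (vtx t ℓ i a) * subE i a b) := by
  have := corner_mem (vtx t ℓ i a) (vtx t ℓ i b) x
    (Submodule.span k {eV (vtx t ℓ i a) * subE i a b})
    (fun p hs he => by rw [pathE_eq hab hb h hs he]; exact Submodule.mem_span_singleton_self _)
  obtain ⟨c, hc⟩ := Submodule.mem_span_singleton.1 this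
  exact ⟨c, hc.symm⟩

lemma corner_left_eq_zero {i : Fin t} {a : ℕ} (ha : a < ℓ i) {v : Vtx t ℓ}
    (hv : ∀ c ≤ a, v ≠ vtx t ℓ i c) (x : PathAlg k t ℓ) :
    eV v * x * eV (vtx t ℓ i a) = 0 := by
  have := corner_mem v (vtx t ℓ i a) x ⊥ ?_
  · simpa using this
  rintro (w | ⟨i', c, d, hcd, hd⟩) hs he
  · exact absurd (hs.symm.trans he) (hv a le_rfl)
  · simp only [startIdx, endIdx] at hs he
    rcases vtx_eq hd ha.le he with ⟨rfl, rfl⟩ | h | h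
    · exact absurd hs.symm (hv c hcd.le)
    all_goals omega

lemma corner_right_eq_zero {i : Fin t} {b : ℕ} (hb : 0 < b) (hb' : b ≤ ℓ i) {v : Vtx t ℓ}
    (hv : ∀ c, b ≤ c → c ≤ ℓ i → v ≠ vtx t ℓ i c) (x : PathAlg k t ℓ) :
    eV (vtx t ℓ i b) * x * eV v = 0 := by
  have := corner_mem (vtx t ℓ i b) v x ⊥ ?_
  · simpa using this
  rintro (w | ⟨i', c, d, hcd, hd⟩) hs he
  · exact absurd (he.symm.trans hs) (hv b le_rfl hb')
  · simp only [startIdx, endIdx] at hs he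
    rcases vtx_eq (hcd.le.trans hd) hb' hs with ⟨rfl, rfl⟩ | h | h
    · exact absurd he.symm (hv d hcd.le hd)
    all_goals omega

lemma sum_eV_mul (x : PathAlg k t ℓ) : ∑ v, eV v * x = x := by
  rw [← Finset.sum_mul, (isPathSystem k t ℓ).sum_one, one_mul]

lemma sum_mul_eV (x : PathAlg k t ℓ) : ∑ v, x * eV v = x := by
  rw [← Finset.mul_sum, (isPathSystem k t ℓ).sum_one, mul_one]

lemma eV_mul_subE {i : Fin t} {a b : ℕ} (hab : a < b) (hb : b ≤ ℓ i) :
    (eV (vtx t ℓ i a) * subE i a b : PathAlg k t ℓ) = subE i a b :=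
  (isPathSystem k t ℓ).start_mul (.sub i a b hab hb)

lemma subE_mul_eV {i : Fin t} {a b : ℕ} (hab : a < b) (hb : b ≤ ℓ i) :
    (subE i a b * eV (vtx t ℓ i b) : PathAlg k t ℓ) = subE i a b :=
  (isPathSystem k t ℓ).mul_end (.sub i a b hab hb)

lemma subE_mul (i : Fin t) {a b c : ℕ} (hab : a ≤ b) (hbc : b ≤ c) :
    (subE i a b * subE i b c : PathAlg k t ℓ) = subE i a c := seg_mul _ hab hbc

lemma subE_succ_self (i : Fin t) (a : ℕ) : (subE i a (a + 1) : PathAlg k t ℓ) = arE i a :=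
  seg_one _ a

lemma subE_self (i : Fin t) (a : ℕ) : (subE i a a : PathAlg k t ℓ) = 1 :=
  seg_self _ a

end Paths

section MatrixRep

variable {k : Type u} [Field k] {t : ℕ} {ℓ : Fin t → ℕ} {Λ : Type*} [CommRing Λ] [Algebra k Λ]

/-- The matrix attached to an arrow, given the scalars by which the arrows act. -/
def matA (G : Fin t → ℕ → Λ) (i : Fin t) (j : ℕ) : Matrix (Vtx t ℓ) (Vtx t ℓ) Λ :=
  if j < ℓ i then Matrix.single (vtx t ℓ i j) (vtx t ℓ i (j + 1)) (G i j) else 0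

lemma isPathSystem_matrix (G : Fin t → ℕ → Λ) :
    IsPathSystem (fun v : Vtx t ℓ => Matrix.single v v (1 : Λ)) (matA G) where
  idem v w := by
    split_ifs with h
    · subst h; simp
    · simp [h]
  sum_one := by
    exact Matrix.sum_single_one
  left i j hj := by simp [matA, hj]
  right i j hj := by simp [matA, hj]
  zero i j hj := by simp [matA, hj.not_gt]

/-- The matrix representation of the path algebra with prescribed action of the arrows. -/
def matRep (G : Fin t → ℕ → Λ) : PathAlg k t ℓ →ₐ[k] Matrix (Vtx t ℓ) (Vtx t ℓ) Λ :=
  (isPathSystem_matrix G).lift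

lemma matRep_eV (G : Fin t → ℕ → Λ) (v : Vtx t ℓ) :
    matRep G (eV v : PathAlg k t ℓ) = Matrix.single v v 1 := (isPathSystem_matrix G).lift_eV v

lemma matRep_arE (G : Fin t → ℕ → Λ) {i : Fin t} {j : ℕ} (hj : j < ℓ i) :
    matRep G (arE i j : PathAlg k t ℓ) =
      Matrix.single (vtx t ℓ i j) (vtx t ℓ i (j + 1)) (G i j) := by
  rw [matRep, IsPathSystem.lift_arE, matA, if_pos hj]

lemma matRep_subE (G : Fin t → ℕ → Λ) {i : Fin t} {a b : ℕ} (hab : a < b) (hb : b ≤ ℓ i) :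
    matRep G (subE i a b : PathAlg k t ℓ) =
      Matrix.single (vtx t ℓ i a) (vtx t ℓ i b) (seg (G i) a b) := by
  induction b, hab using Nat.le_induction with
  | base => rw [subE_succ_self, matRep_arE G (by omega), seg_one]
  | succ b hab ih =>
    rw [← subE_mul i (show a ≤ b by omega) (Nat.le_succ b), map_mul, ih (by omega),
      subE_succ_self, matRep_arE G (by omega), Matrix.single_mul_single_same,
      seg_succ _ (by omega)]

lemma seg_eq_zero {G : ℕ → Λ} {a b j : ℕ} (haj : a ≤ j) (hjb : j < b) (h : G j = 0) :
    seg G a b = 0 := by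
  rw [← seg_mul G haj hjb.le, ← mul_seg G hjb, h, zero_mul, mul_zero]

lemma seg_eq_one {G : ℕ → Λ} {a b : ℕ} (h : ∀ j, a ≤ j → j < b → G j = 1) :
    seg G a b = 1 := by
  rw [seg]
  apply List.prod_eq_one
  simp only [List.mem_map, List.mem_range]
  rintro _ ⟨s, hs, rfl⟩
  exact h _ (by omega) (by omega)

end MatrixRep

end Toupie

namespace Toupie

section Ideal

variable {k : Type u} [Field k] (T : ToupieAlg k)

lemma mkA_eq_zero_iff (x : PathAlg k T.t T.ℓ) : mkA T x = 0 ↔ x ∈ T.I := by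
  rw [TwoSidedIdeal.mem_iff, ← map_zero (mkA T)]
  exact RingCon.eq T.I.ringCon

variable {T}

lemma smul_mem_I {x : PathAlg k T.t T.ℓ} (c : k) (hx : x ∈ T.I) : c • x ∈ T.I := by
  rw [Algebra.smul_def]
  exact T.I.mul_mem_left _ _ hx

lemma eq_zero_of_smul_mem_I {x : PathAlg k T.t T.ℓ} {c : k} (hx : x ∉ T.I) (h : c • x ∈ T.I) :
    c = 0 := by
  by_contra hc
  apply hx
  simpa [smul_smul, inv_mul_cancel₀ hc] using smul_mem_I c⁻¹ h

lemma subE_mem_mono {i : Fin T.t} {a b c d : ℕ} (hca : c ≤ a) (hab : a ≤ b) (hbd : b ≤ d)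
    (h : subE i a b ∈ T.I) : subE i c d ∈ T.I := by
  rw [← subE_mul i hca (hab.trans hbd), ← subE_mul i hab hbd]
  exact T.I.mul_mem_left _ _ (T.I.mul_mem_right _ _ h)

lemma matRep_eq_zero_of_mem {Λ : Type*} [CommRing Λ] [Algebra k Λ] {G : Fin T.t → ℕ → Λ}
    (hG : ∀ i a b, a + 2 ≤ b → b ≤ T.ℓ i → seg (G i) a b = 0) {x : PathAlg k T.t T.ℓ}
    (hx : x ∈ T.I) : matRep G x = 0 := by
  replace hx := T.adm x hx
  induction hx using Submodule.span_induction with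
  | mem x hx =>
    obtain ⟨i, a, b, hab, hb, rfl⟩ := hx
    rw [matRep_subE G (by omega) hb, hG i a b hab hb, Matrix.single_zero]
  | zero => simp
  | add x y _ _ hx hy => rw [map_add, hx, hy, add_zero]
  | smul c x _ hx => rw [map_smul, hx, smul_zero]

lemma eV_notMem (v : Vtx T.t T.ℓ) : eV v ∉ T.I := by
  intro h
  have h0 := matRep_eq_zero_of_mem (Λ := k) (G := fun _ _ => 0)
    (fun i a b hab hb => seg_eq_zero le_rfl (by omega) rfl) h
  rw [matRep_eV] at h0
  simpa using congrFun (congrFun h0 v) v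

lemma arE_notMem {i : Fin T.t} {a : ℕ} (ha : a < T.ℓ i) : arE i a ∉ T.I := by
  intro h
  have h0 := matRep_eq_zero_of_mem (Λ := k) (G := fun _ j => if j = a then 1 else 0)
    (fun i c b hab hb => by
      by_cases hc : c = a
      · exact seg_eq_zero (j := c + 1) (by omega) (by omega) (if_neg (by omega))
      · exact seg_eq_zero (j := c) (by omega) (by omega) (if_neg (by omega))) h
  rw [matRep_arE _ ha] at h0
  simpa using congrFun (congrFun h0 (vtx T.t T.ℓ i a)) (vtx T.t T.ℓ i (a + 1))

/-- A linear map vanishes on `I` as soon as it vanishes on the subpaths of branches in `I` and on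
the part of `I` running from the source to the sink. -/
lemma eq_zero_of_mem_I {Y : Type*} [AddCommGroup Y] [Module k Y] (ρ : PathAlg k T.t T.ℓ →ₗ[k] Y)
    (h1 : ∀ i a b, a < b → b ≤ T.ℓ i → ¬ (a = 0 ∧ b = T.ℓ i) → subE i a b ∈ T.I →
      ρ (subE i a b) = 0)
    (h2 : ∀ x ∈ T.I, ρ (eV .src * x * eV .snk) = 0) {x : PathAlg k T.t T.ℓ} (hx : x ∈ T.I) :
    ρ x = 0 := by
  have hcor : ∀ u v, ρ (eV u * x * eV v) = 0 := by
    intro u v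
    have hI : eV u * x * eV v ∈ T.I := T.I.mul_mem_right _ _ (T.I.mul_mem_left _ _ hx)
    by_cases huv : u = .src ∧ v = .snk
    · obtain ⟨rfl, rfl⟩ := huv
      exact h2 x hx
    by_cases hp : ∃ p, startIdx p = u ∧ endIdx p = v
    · obtain ⟨p, rfl, rfl⟩ := hp
      rcases p with w | ⟨i, a, b, hab, hb⟩
      · obtain ⟨i, a, ha, rfl⟩ := exists_eq_vtx ⟨0, by have := T.ht; omega⟩ T.hℓ w
        have := T.hℓ i
        obtain ⟨c, hc⟩ := exists_corner_eq_smul le_rfl ha (by omega) x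
        simp only [startIdx, endIdx] at hI ⊢
        rw [subE_self, mul_one] at hc
        rw [hc] at hI ⊢
        rw [eq_zero_of_smul_mem_I (eV_notMem _) hI, zero_smul, map_zero]
      · simp only [startIdx, endIdx] at hI huv ⊢
        have hab' : ¬ (a = 0 ∧ b = T.ℓ i) := by
          rintro ⟨rfl, rfl⟩
          exact huv ⟨vtx_zero i, vtx_self (T.hℓ i)⟩
        obtain ⟨c, hc⟩ := exists_corner_eq_smul hab.le hb hab' x
        rw [eV_mul_subE hab hb] at hc
        rw [hc] at hI ⊢
        by_cases hs : subE i a b ∈ T.I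
        · rw [map_smul, h1 i a b hab hb hab' hs, smul_zero]
        · rw [eq_zero_of_smul_mem_I hs hI, zero_smul, map_zero]
    · have := corner_mem u v x ⊥ fun p hs he => absurd ⟨p, hs, he⟩ hp
      rw [Submodule.mem_bot] at this
      rw [this, map_zero]
  rw [← sum_mul_eV x, map_sum]
  refine Finset.sum_eq_zero fun v _ => ?_
  rw [← sum_eV_mul (x * eV v), map_sum]
  refine Finset.sum_eq_zero fun u _ => ?_
  rw [← mul_assoc, hcor]

lemma exists_start {i : Fin T.t} (h : branchInI T i) :
    ∃ a d, a + 2 ≤ d ∧ d ≤ T.ℓ i ∧ subE i a d ∈ T.I ∧ subE i (a + 1) d ∉ T.I ∧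
      ∀ c e, c ≤ e → e < d → subE i c e ∉ T.I := by
  have hex : ∃ d, subE i 0 d ∈ T.I := ⟨T.ℓ i, h⟩
  have hd := Nat.find_spec hex
  have hdℓ : Nat.find hex ≤ T.ℓ i := Nat.find_min' hex h
  have hlt : ∀ c e, c ≤ e → e < Nat.find hex → subE i c e ∉ T.I := fun c e hce he hI =>
    Nat.find_min hex he (subE_mem_mono (Nat.zero_le c) hce le_rfl hI)
  generalize Nat.find hex = d at *
  have hself : ∀ c, c < T.ℓ i → subE i c c ∉ T.I := by
    intro c hc hI
    rw [subE_self] at hI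
    refine arE_notMem hc ?_
    simpa using T.I.mul_mem_left (arE i c) _ hI
  have hd0 : subE i d d ∉ T.I := by
    intro hI
    rw [subE_self] at hI
    refine eV_notMem (T := T) .src ?_
    simpa using T.I.mul_mem_left (eV .src) _ hI
  have hn : ∃ n, subE i (n + 1) d ∉ T.I := by
    refine ⟨d - 1, ?_⟩
    rcases Nat.eq_zero_or_pos d with rfl | hpos
    · exact absurd hd hd0
    · rwa [Nat.sub_add_cancel hpos]
  have hnd := Nat.find_spec hn
  have hna : subE i (Nat.find hn) d ∈ T.I := by
    rcases h0 : Nat.find hn with _ | n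
    · exact hd
    · by_contra hc
      exact Nat.find_min hn (m := n) (by omega) hc
  have hle : Nat.find hn ≤ d - 1 := by
    refine Nat.find_min' hn ?_
    rcases Nat.eq_zero_or_pos d with rfl | hpos
    · exact absurd hd hd0
    · rwa [Nat.sub_add_cancel hpos]
  generalize Nat.find hn = a at *
  refine ⟨a, d, ?_, hdℓ, hna, hnd, hlt⟩
  by_contra hcon
  have hd' : d ≠ 0 := by rintro rfl; exact hd0 hd
  obtain rfl : d = a + 1 := by omega
  rw [subE_succ_self] at hna
  exact arE_notMem (by omega) hna

lemma exists_end {i : Fin T.t} (h : branchInI T i) :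
    ∃ a d, a + 2 ≤ d ∧ d ≤ T.ℓ i ∧ subE i a d ∈ T.I ∧ subE i a (d - 1) ∉ T.I ∧
      ∀ c e, a < c → c ≤ e → e ≤ T.ℓ i → subE i c e ∉ T.I := by
  have hex : ∃ n, n ≤ T.ℓ i ∧ subE i (T.ℓ i - n) (T.ℓ i) ∈ T.I :=
    ⟨T.ℓ i, le_rfl, by rw [Nat.sub_self]; exact h⟩
  obtain ⟨hmℓ, hm⟩ := Nat.find_spec hex
  have hlt : ∀ c e, T.ℓ i - Nat.find hex < c → c ≤ e → e ≤ T.ℓ i → subE i c e ∉ T.I := by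
    intro c e hc hce he hI
    refine Nat.find_min hex (m := T.ℓ i - c) (by omega) ⟨by omega, ?_⟩
    rw [Nat.sub_sub_self (hce.trans he)]
    exact subE_mem_mono le_rfl hce he hI
  generalize hn : Nat.find hex = n at *
  have hone : (1 : PathAlg k T.t T.ℓ) ∉ T.I := by
    intro hI
    refine eV_notMem (T := T) .src ?_
    simpa using T.I.mul_mem_left (eV .src) _ hI
  generalize ha : T.ℓ i - n = a at *
  have hex' : ∃ d, a ≤ d ∧ subE i a d ∈ T.I := ⟨T.ℓ i, by omega, hm⟩
  obtain ⟨had, hd⟩ := Nat.find_spec hex'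
  have hdℓ : Nat.find hex' ≤ T.ℓ i := Nat.find_min' hex' ⟨by omega, hm⟩
  have hmin := fun m => Nat.find_min hex' (m := m)
  generalize Nat.find hex' = d at *
  have h0 : d ≠ a := by
    rintro rfl
    rw [subE_self] at hd
    exact hone hd
  have h1 : d ≠ a + 1 := by
    rintro rfl
    rw [subE_succ_self] at hd
    exact arE_notMem (by omega) hd
  exact ⟨a, d, by omega, hdℓ, hd, fun hI => hmin (d - 1) (by omega) ⟨by omega, hI⟩, hlt⟩

end Ideal

end Toupie

namespace Toupie

section ToupieHomological

variable {k : Type u} [Field k] {T : ToupieAlg k}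

lemma not_pdLeOne_of_start (M : ModuleCat.{u} (Alg T)ᵐᵒᵖ) {i : Fin T.t} {a d : ℕ}
    (had : a + 2 ≤ d) (hd : d ≤ T.ℓ i) (hI : subE i a d ∈ T.I) (hI' : subE i (a + 1) d ∉ T.I)
    (hlt : ∀ c e, c ≤ e → e < d → subE i c e ∉ T.I) {w : M}
    (hw : actV T (vtx T.t T.ℓ i a) • w = w) (hw0 : w ≠ 0)
    (hαw : op (mkA T (arE i a)) • w = 0) : ¬ PdLeOne (Alg T)ᵐᵒᵖ M := by
  have hS := isPathSystem k T.t T.ℓ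
  refine not_pdLeOne M (α := op (mkA T (arE i a))) (e := actV T (vtx T.t T.ℓ i a))
    (e' := actV T (vtx T.t T.ℓ i (a + 1))) (q := op (mkA T (subE i (a + 1) d))) ?_ ?_ ?_ ?_
    hw hw0 hαw
  · intro x hx
    obtain ⟨x, rfl⟩ := op_surjective x
    obtain ⟨x, rfl⟩ := mkA_surjective T x
    rw [← op_mul, ← map_mul, op_eq_zero_iff, mkA_eq_zero_iff] at hx
    rw [actV, ← op_mul, ← map_mul, op_eq_zero_iff, mkA_eq_zero_iff]
    rw [← sum_eV_mul (x * _)]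
    refine sum_mem fun v _ => ?_
    rw [← mul_assoc]
    by_cases hv : ∃ c ≤ a, v = vtx T.t T.ℓ i c
    · obtain ⟨c, hc, rfl⟩ := hv
      obtain ⟨s, hs⟩ := exists_corner_eq_smul (i := i) hc (by omega) (by omega) x
      rw [hs]
      suffices s = 0 by rw [this, zero_smul]; exact T.I.zero_mem
      refine eq_zero_of_smul_mem_I (hlt c (a + 1) (by omega) (by omega)) ?_
      have := T.I.mul_mem_left (eV (vtx T.t T.ℓ i c)) _ hx
      rwa [← hS.left i a (by omega), ← mul_assoc, ← mul_assoc, hs, smul_mul_assoc, mul_assoc,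
        ← subE_succ_self, subE_mul i hc (Nat.le_succ a), eV_mul_subE (by omega) (by omega)] at this
    · push Not at hv
      rw [corner_left_eq_zero (show _ < T.ℓ i by omega) hv]
      exact T.I.zero_mem
  · intro x hx
    obtain ⟨x, rfl⟩ := op_surjective x
    obtain ⟨x, rfl⟩ := mkA_surjective T x
    rw [← op_mul, ← map_mul, op_eq_zero_iff, mkA_eq_zero_iff] at hx
    suffices ∃ y, x * eV (vtx T.t T.ℓ i (a + 1)) = y * arE i a by
      obtain ⟨y, hy⟩ := this
      exact ⟨op (mkA T y), by rw [actV, ← op_mul, ← op_mul, ← map_mul, ← map_mul, hy]⟩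
    have key : ∀ v, ∃ y, eV v * x * eV (vtx T.t T.ℓ i (a + 1)) = y * arE i a := by
      intro v
      by_cases hv : ∃ c ≤ a + 1, v = vtx T.t T.ℓ i c
      · obtain ⟨c, hc, rfl⟩ := hv
        obtain ⟨s, hs⟩ := exists_corner_eq_smul (i := i) hc (by omega) (by omega) x
        rw [hs]
        rcases Nat.lt_or_ge a c with hca | hca
        · obtain rfl : c = a + 1 := by omega
          suffices s = 0 from ⟨0, by rw [this, zero_smul, zero_mul]⟩
          refine eq_zero_of_smul_mem_I hI' ?_
          have := T.I.mul_mem_left (eV (vtx T.t T.ℓ i (a + 1))) _ hx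
          rwa [← eV_mul_subE (by omega) hd, ← mul_assoc, ← mul_assoc, hs, smul_mul_assoc,
            subE_self, mul_one, eV_mul_subE (by omega) hd] at this
        · refine ⟨s • (eV (vtx T.t T.ℓ i c) * subE i c a), ?_⟩
          rw [smul_mul_assoc, mul_assoc, ← subE_succ_self, subE_mul i hca (Nat.le_succ a)]
      · push Not at hv
        exact ⟨0, by rw [corner_left_eq_zero (show _ < T.ℓ i by omega) hv, zero_mul]⟩
    choose y hy using key
    refine ⟨∑ v, y v, ?_⟩
    rw [Finset.sum_mul, ← sum_eV_mul (x * _)]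
    exact Finset.sum_congr rfl fun v _ => by rw [← mul_assoc, hy]
  · rw [← op_mul, ← map_mul, op_eq_zero_iff, mkA_eq_zero_iff, ← subE_succ_self,
      subE_mul i (Nat.le_succ a) (by omega)]
    exact hI
  · rw [actV, ← op_mul, ← map_mul, hS.right i a (by omega)]

lemma not_idLeOne_of_end (M : ModuleCat.{u} (Alg T)ᵐᵒᵖ) {i : Fin T.t} {a b : ℕ}
    (hab : a + 2 ≤ b + 1) (hb : b + 1 ≤ T.ℓ i) (hI : subE i a (b + 1) ∈ T.I)
    (hI' : subE i a b ∉ T.I)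
    (hlt : ∀ c e, a < c → c ≤ e → e ≤ T.ℓ i → subE i c e ∉ T.I) {w : M}
    (hw : actV T (vtx T.t T.ℓ i (b + 1)) • w = w)
    (hβw : ∀ m : M, op (mkA T (arE i b)) • m ≠ w) : ¬ IdLeOne (Alg T)ᵐᵒᵖ M := by
  have hS := isPathSystem k T.t T.ℓ
  refine not_idLeOne M (β := op (mkA T (arE i b))) (e := actV T (vtx T.t T.ℓ i (b + 1)))
    (e' := actV T (vtx T.t T.ℓ i b)) (q := op (mkA T (subE i a b))) ?_ ?_ ?_ ?_ hw hβw
  · intro x hx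
    obtain ⟨x, rfl⟩ := op_surjective x
    obtain ⟨x, rfl⟩ := mkA_surjective T x
    rw [← op_mul, ← map_mul, op_eq_zero_iff, mkA_eq_zero_iff] at hx
    rw [actV, ← op_mul, ← map_mul, op_eq_zero_iff, mkA_eq_zero_iff]
    rw [← sum_mul_eV (_ * x)]
    refine sum_mem fun v _ => ?_
    by_cases hv : ∃ c, b + 1 ≤ c ∧ c ≤ T.ℓ i ∧ v = vtx T.t T.ℓ i c
    · obtain ⟨c, hc, hcℓ, rfl⟩ := hv
      obtain ⟨s, hs⟩ := exists_corner_eq_smul hc hcℓ (by omega) x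
      rw [hs]
      suffices s = 0 by rw [this, zero_smul]; exact T.I.zero_mem
      refine eq_zero_of_smul_mem_I (hlt b c (by omega) (by omega) hcℓ) ?_
      have := T.I.mul_mem_right _ (eV (vtx T.t T.ℓ i c)) hx
      rwa [← hS.right i b (by omega), mul_assoc, mul_assoc, ← mul_assoc (eV _), hs,
        mul_smul_comm, ← mul_assoc, hS.right i b (by omega),
        ← subE_succ_self, subE_mul i (Nat.le_succ b) hc] at this
    · push Not at hv
      rw [corner_right_eq_zero (by omega) hb hv]
      exact T.I.zero_mem
  · intro x hx
    obtain ⟨x, rfl⟩ := op_surjective x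
    obtain ⟨x, rfl⟩ := mkA_surjective T x
    rw [← op_mul, ← map_mul, op_eq_zero_iff, mkA_eq_zero_iff] at hx
    suffices ∃ y, eV (vtx T.t T.ℓ i b) * x = arE i b * y by
      obtain ⟨y, hy⟩ := this
      exact ⟨op (mkA T y), by rw [actV, ← op_mul, ← op_mul, ← map_mul, ← map_mul, hy]⟩
    have key : ∀ v, ∃ y, eV (vtx T.t T.ℓ i b) * x * eV v = arE i b * y := by
      intro v
      by_cases hv : ∃ c, b ≤ c ∧ c ≤ T.ℓ i ∧ v = vtx T.t T.ℓ i c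
      · obtain ⟨c, hc, hcℓ, rfl⟩ := hv
        obtain ⟨s, hs⟩ := exists_corner_eq_smul hc hcℓ (by omega) x
        rw [hs]
        rcases Nat.eq_or_lt_of_le hc with rfl | hbc
        · suffices s = 0 from ⟨0, by rw [this, zero_smul, mul_zero]⟩
          refine eq_zero_of_smul_mem_I hI' ?_
          have := T.I.mul_mem_right _ (eV (vtx T.t T.ℓ i b)) hx
          rwa [← subE_mul_eV (by omega) hcℓ, mul_assoc, mul_assoc, ← mul_assoc (eV _), hs,
            mul_smul_comm, subE_self, mul_one, subE_mul_eV (by omega) hcℓ] at this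
        · refine ⟨s • subE i (b + 1) c, ?_⟩
          rw [mul_smul_comm, eV_mul_subE hbc hcℓ, ← subE_succ_self, subE_mul i (Nat.le_succ b) hbc]
      · push Not at hv
        exact ⟨0, by rw [corner_right_eq_zero (by omega) (by omega) hv, mul_zero]⟩
    choose y hy using key
    refine ⟨∑ v, y v, ?_⟩
    rw [Finset.mul_sum, ← sum_mul_eV (_ * x)]
    exact Finset.sum_congr rfl fun v _ => hy v
  · rw [← op_mul, ← map_mul, op_eq_zero_iff, mkA_eq_zero_iff, ← subE_succ_self,
      subE_mul i (by omega) (Nat.le_succ b)]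
    exact hI
  · rw [actV, ← op_mul, ← map_mul, hS.left i b (by omega)]

end ToupieHomological

end Toupie

namespace Toupie

/-! ### Band modules -/

variable {k : Type u} [Field k] {T : ToupieAlg k}

/-- Positions on the branches in `I`: `fst i` is the starting point of the first zero relation
on branch `i`, and `lst i` is the end point of the last one. -/
structure Cut (T : ToupieAlg k) where
  fst : Fin T.t → ℕ
  lst : Fin T.t → ℕ
  isStart : ∀ i, branchInI T i → ∃ d, fst i + 2 ≤ d ∧ d ≤ T.ℓ i ∧ subE i (fst i) d ∈ T.I ∧
    subE i (fst i + 1) d ∉ T.I ∧ ∀ c e, c ≤ e → e < d → subE i c e ∉ T.I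
  isEnd : ∀ i, branchInI T i → ∃ a, a + 2 ≤ lst i ∧ lst i ≤ T.ℓ i ∧ subE i a (lst i) ∈ T.I ∧
    subE i a (lst i - 1) ∉ T.I ∧ ∀ c e, a < c → c ≤ e → e ≤ T.ℓ i → subE i c e ∉ T.I

lemma nonempty_cut (T : ToupieAlg k) : Nonempty (Cut T) := by
  have h1 : ∀ i, ∃ a, branchInI T i → ∃ d, a + 2 ≤ d ∧ d ≤ T.ℓ i ∧ subE i a d ∈ T.I ∧
      subE i (a + 1) d ∉ T.I ∧ ∀ c e, c ≤ e → e < d → subE i c e ∉ T.I := by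
    intro i
    by_cases h : branchInI T i
    · obtain ⟨a, ha⟩ := exists_start h
      exact ⟨a, fun _ => ha⟩
    · exact ⟨0, fun h' => absurd h' h⟩
  have h2 : ∀ i, ∃ b, branchInI T i → ∃ a, a + 2 ≤ b ∧ b ≤ T.ℓ i ∧ subE i a b ∈ T.I ∧
      subE i a (b - 1) ∉ T.I ∧ ∀ c e, a < c → c ≤ e → e ≤ T.ℓ i → subE i c e ∉ T.I := by
    intro i
    by_cases h : branchInI T i
    · obtain ⟨a, b, hab⟩ := exists_end h
      exact ⟨b, fun _ => ⟨a, hab⟩⟩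
    · exact ⟨0, fun h' => absurd h' h⟩
  choose a ha using h1
  choose b hb using h2
  exact ⟨⟨a, b, ha, hb⟩⟩

/-- The quotient map `kQ → A` as an algebra homomorphism. -/
def mkAlg (T : ToupieAlg k) : PathAlg k T.t T.ℓ →ₐ[k] Alg T :=
  { mkA T with commutes' := fun _ => rfl }

namespace Cut

variable (C : Cut T)

lemma fst_add_two_le {i : Fin T.t} (hi : branchInI T i) : C.fst i + 2 ≤ C.lst i := by
  obtain ⟨d, h1, h2, h3, -, -⟩ := C.isStart i hi
  obtain ⟨c, h4, h5, h6, -, h7⟩ := C.isEnd i hi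
  by_contra h
  exact h7 (C.fst i) d (by omega) (by omega) h2 h3

lemma lst_le {i : Fin T.t} (hi : branchInI T i) : C.lst i ≤ T.ℓ i := by
  obtain ⟨c, h4, h5, -⟩ := C.isEnd i hi
  exact h5

lemma subE_notMem_of_le_fst {i : Fin T.t} (hi : branchInI T i) {c e : ℕ} (hce : c ≤ e)
    (he : e ≤ C.fst i) : subE i c e ∉ T.I := by
  obtain ⟨d, h1, -, -, -, h⟩ := C.isStart i hi
  exact h c e hce (by omega)

lemma subE_notMem_of_lst_le {i : Fin T.t} (hi : branchInI T i) {c e : ℕ} (hce : c ≤ e)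
    (hc : C.lst i ≤ c) (he : e ≤ T.ℓ i) : subE i c e ∉ T.I := by
  obtain ⟨a, h1, -, -, -, h⟩ := C.isEnd i hi
  exact h c e (by omega) hce he

/-- The vertices supporting the band modules. -/
def Live : Vtx T.t T.ℓ → Prop
  | .src => True
  | .snk => True
  | .mid i y => branchInI T i → y + 1 ≤ C.fst i ∨ C.lst i ≤ y + 1

lemma live_vtx {i : Fin T.t} {y : ℕ} (h : branchInI T i → y ≤ C.fst i ∨ C.lst i ≤ y) :
    C.Live (vtx T.t T.ℓ i y) := by
  rw [vtx]
  split_ifs with h1 h2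
  · trivial
  · intro hi
    have := h hi
    simp only
    omega
  · trivial

lemma of_live_vtx {i : Fin T.t} {y : ℕ} (hi : branchInI T i) (hy : y ≤ T.ℓ i)
    (h : C.Live (vtx T.t T.ℓ i y)) : y ≤ C.fst i ∨ C.lst i ≤ y := by
  have := C.lst_le hi
  rw [vtx] at h
  split_ifs at h with h1 h2
  · omega
  · have := h hi
    simp only at this
    omega
  · omega

variable {Λ : Type u} [CommRing Λ] [Algebra k Λ] (ψ : Alg T →ₗ[k] Λ)

/-- The scalars by which the arrows act on a band module. -/
def scal (i : Fin T.t) (j : ℕ) : Λ :=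
  if branchInI T i then (if j < C.fst i ∨ C.lst i ≤ j then 1 else 0)
  else if j + 1 < T.ℓ i then 1 else ψ (mkA T (wE i))

lemma seg_scal_of_branchInI {i : Fin T.t} (hi : branchInI T i) {a b : ℕ}
    (h : b ≤ C.fst i ∨ C.lst i ≤ a) : seg (C.scal ψ i) a b = 1 := by
  refine seg_eq_one fun j h1 h2 => ?_
  rw [scal, if_pos hi, if_pos (by omega)]

lemma seg_scal_eq_zero {i : Fin T.t} (hi : branchInI T i) {a b : ℕ} (hab : a < b)
    (h1 : C.fst i < b) (h2 : a < C.lst i) : seg (C.scal ψ i) a b = 0 := by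
  have := C.fst_add_two_le hi
  refine seg_eq_zero (j := max a (C.fst i)) (by omega) (by omega) ?_
  rw [scal, if_pos hi, if_neg (by omega)]

lemma seg_scal_of_not {i : Fin T.t} (hi : ¬ branchInI T i) {a b : ℕ} (hb : b < T.ℓ i) :
    seg (C.scal ψ i) a b = 1 := by
  refine seg_eq_one fun j h1 h2 => ?_
  rw [scal, if_neg hi, if_pos (by omega)]

lemma seg_scal_branch (i : Fin T.t) : seg (C.scal ψ i) 0 (T.ℓ i) = ψ (mkA T (wE i)) := by
  have hℓ := T.hℓ i
  by_cases hi : branchInI T i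
  · have := C.fst_add_two_le hi
    have := C.lst_le hi
    rw [C.seg_scal_eq_zero ψ hi (by omega) (by omega) (by omega), (mkA_eq_zero_iff T _).2 hi,
      map_zero]
  · obtain ⟨n, hn⟩ : ∃ n, T.ℓ i = n + 1 := ⟨T.ℓ i - 1, by omega⟩
    rw [hn, ← seg_mul _ (Nat.zero_le n) (Nat.le_succ n), C.seg_scal_of_not ψ hi (by omega), one_mul,
      seg_one, scal, if_neg hi, if_neg (by omega)]

lemma matRep_corner (x : PathAlg k T.t T.ℓ) :
    matRep (C.scal ψ) (eV .src * x * eV .snk) =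
      Matrix.single Vtx.src Vtx.snk (ψ (mkA T (eV .src * x * eV .snk))) := by
  refine corner_mem .src .snk x (LinearMap.eqLocus (matRep (C.scal ψ)).toLinearMap
    ((Matrix.singleLinearMap k Vtx.src Vtx.snk).comp (ψ.comp (mkAlg T).toLinearMap))) ?_
  rintro (v | ⟨i, a, b, hab, hb⟩) hs he
  · simp only [startIdx, endIdx] at hs he
    simp [hs] at he
  · simp only [startIdx, endIdx] at hs he
    have ha0 : a = 0 := by
      rcases vtx_eq (by omega) (Nat.zero_le (T.ℓ i)) (hs.trans (vtx_zero i).symm) with h | h | h <;>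
      omega
    have hbℓ : b = T.ℓ i := by
      rcases vtx_eq hb le_rfl (he.trans (vtx_self (T.hℓ i)).symm) with h | h | h <;> omega
    subst ha0 hbℓ
    change matRep (C.scal ψ) (subE i 0 (T.ℓ i)) = Matrix.single _ _ (ψ (mkA T (wE i)))
    rw [matRep_subE _ hab le_rfl, seg_scal_branch, vtx_zero, vtx_self (T.hℓ i)]

lemma matRep_eq_zero {x : PathAlg k T.t T.ℓ} (hx : x ∈ T.I) : matRep (C.scal ψ) x = 0 := by
  refine eq_zero_of_mem_I (matRep (C.scal ψ)).toLinearMap ?_ ?_ hx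
  · intro i a b hab hb hne hI
    change matRep (C.scal ψ) _ = 0
    have hi : branchInI T i := subE_mem_mono (Nat.zero_le a) hab.le hb hI
    rw [matRep_subE _ hab hb, C.seg_scal_eq_zero ψ hi hab, Matrix.single_zero]
    · by_contra h
      exact C.subE_notMem_of_le_fst hi hab.le (by omega) hI
    · by_contra h
      exact C.subE_notMem_of_lst_le hi hab.le (by omega) hb hI
  · intro y hy
    change matRep (C.scal ψ) _ = 0
    rw [matRep_corner, (mkA_eq_zero_iff T _).2, map_zero, Matrix.single_zero]
    exact T.I.mul_mem_right _ _ (T.I.mul_mem_left _ _ hy)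

/-- The matrix representation of `A` defining a band module. -/
def rep : Alg T →ₐ[k] Matrix (Vtx T.t T.ℓ) (Vtx T.t T.ℓ) Λ :=
  { RingCon.lift T.I.ringCon (matRep (C.scal ψ)).toRingHom (by
      intro x y hxy
      have : x - y ∈ T.I := (TwoSidedIdeal.rel_iff T.I x y).1 hxy
      have := C.matRep_eq_zero ψ this
      exact sub_eq_zero.1 ((map_sub (matRep (C.scal ψ)).toRingHom x y).symm.trans this)) with
    commutes' := fun c => (matRep (C.scal ψ)).commutes c }

end Cut

end Toupie

namespace Toupie

namespace Cut

variable {k : Type u} [Field k] {T : ToupieAlg k} (C : Cut T)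
variable {Λ : Type u} [CommRing Λ] [Algebra k Λ] (ψ : Alg T →ₗ[k] Λ)

/-- The space of row vectors on which `A` acts through `Cut.rep`. -/
def Row (_ : Cut T) (_ : Alg T →ₗ[k] Λ) : Type u := Vtx T.t T.ℓ → Λ

instance : AddCommGroup (C.Row ψ) := inferInstanceAs (AddCommGroup (Vtx T.t T.ℓ → Λ))

instance : Module k (C.Row ψ) := inferInstanceAs (Module k (Vtx T.t T.ℓ → Λ))

instance : Module (Alg T)ᵐᵒᵖ (C.Row ψ) where
  smul r m := Matrix.vecMul (m : Vtx T.t T.ℓ → Λ) (C.rep ψ r.unop)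
  one_smul (m : Vtx T.t T.ℓ → Λ) :=
    (congrArg (Matrix.vecMul m) (map_one (C.rep ψ))).trans (Matrix.vecMul_one m)
  mul_smul r s (m : Vtx T.t T.ℓ → Λ) :=
    (congrArg (Matrix.vecMul m) (map_mul (C.rep ψ) s.unop r.unop)).trans
      (Matrix.vecMul_vecMul m _ _).symm
  smul_zero _ := Matrix.zero_vecMul _
  smul_add _ _ _ := Matrix.add_vecMul _ _ _
  add_smul r s (m : Vtx T.t T.ℓ → Λ) :=
    (congrArg (Matrix.vecMul m) (map_add (C.rep ψ) r.unop s.unop)).trans (Matrix.vecMul_add _ _ m)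
  zero_smul (m : Vtx T.t T.ℓ → Λ) :=
    (congrArg (Matrix.vecMul m) (map_zero (C.rep ψ))).trans (Matrix.vecMul_zero m)

instance : IsScalarTower k (Alg T)ᵐᵒᵖ (C.Row ψ) where
  smul_assoc c r (m : Vtx T.t T.ℓ → Λ) :=
    (congrArg (Matrix.vecMul m) (map_smul (C.rep ψ) c r.unop)).trans (Matrix.vecMul_smul m c _)

lemma vecMul_single_apply {n : Type*} [Fintype n] [DecidableEq n] (m : n → Λ) (u v : n) (g : Λ) :
    Matrix.vecMul m (Matrix.single u v g) = Pi.single v (m u * g) := by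
  ext w
  by_cases h : v = w
  · subst h
    simp [Matrix.vecMul, dotProduct, Matrix.single_apply]
  · simp [Matrix.vecMul, dotProduct, h, Ne.symm h]

/-- A row vector vanishes at the vertices that are not live. -/
def IsSupported (m : Vtx T.t T.ℓ → Λ) : Prop := ∀ v, ¬ C.Live v → m v = 0

omit [Algebra k Λ] in
lemma isSupported_single {v : Vtx T.t T.ℓ} (hv : C.Live v) (x : Λ) :
    C.IsSupported (Pi.single v x) := by
  intro w hw
  have : w ≠ v := by rintro rfl; exact hw hv
  simp [this]

lemma isSupported_smul (x : PathAlg k T.t T.ℓ) {m : Vtx T.t T.ℓ → Λ} (hm : C.IsSupported m) :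
    C.IsSupported (Matrix.vecMul m (matRep (C.scal ψ) x)) := by
  rw [eq_sum_pathE x]
  intro v hv
  rw [map_sum, Matrix.vecMul_sum, Finset.sum_apply]
  refine Finset.sum_eq_zero fun p _ => ?_
  rw [map_smul, Matrix.vecMul_smul, Pi.smul_apply]
  suffices (Matrix.vecMul m (matRep (C.scal ψ) (pathE p))) v = 0 by rw [this, smul_zero]
  rcases p with w | ⟨i, a, b, hab, hb⟩
  · change (Matrix.vecMul m (matRep (C.scal ψ) (eV w))) v = 0
    rw [matRep_eV, vecMul_single_apply, mul_one]
    by_cases hw : w = v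
    · subst hw
      simp [hm w hv]
    · simp [Ne.symm hw]
  · change (Matrix.vecMul m (matRep (C.scal ψ) (subE i a b))) v = 0
    rw [matRep_subE _ hab hb, vecMul_single_apply]
    by_cases hw : vtx T.t T.ℓ i b = v
    · subst hw
      rw [Pi.single_eq_same]
      by_cases hi : branchInI T i
      · have h1 : C.fst i < b ∧ b < C.lst i := by
          by_contra h
          exact hv (C.live_vtx fun _ => by omega)
        rw [C.seg_scal_eq_zero ψ hi hab h1.1 (by omega), mul_zero]
      · exact absurd (C.live_vtx fun h => absurd h hi) hv
    · simp [Ne.symm hw]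

/-- The band module as a submodule of the space of row vectors. -/
def band : Submodule (Alg T)ᵐᵒᵖ (C.Row ψ) where
  carrier := {m | C.IsSupported (m : Vtx T.t T.ℓ → Λ)}
  add_mem' {m n} hm hn v hv := by
    change (m : Vtx T.t T.ℓ → Λ) v + (n : Vtx T.t T.ℓ → Λ) v = 0
    rw [hm v hv, hn v hv, add_zero]
  zero_mem' _ _ := rfl
  smul_mem' r m hm := by
    obtain ⟨r, rfl⟩ := op_surjective r
    obtain ⟨x, rfl⟩ := mkA_surjective T r
    exact C.isSupported_smul ψ x hm

/-- The coordinate of an element of the band module at a vertex. -/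
def coord (m : C.band ψ) (v : Vtx T.t T.ℓ) : Λ := (m.1 : Vtx T.t T.ℓ → Λ) v

variable {ψ} in
lemma band_ext {m n : C.band ψ} (h : ∀ v, C.Live v → C.coord ψ m v = C.coord ψ n v) : m = n := by
  refine Subtype.ext (funext fun v => ?_)
  by_cases hv : C.Live v
  · exact h v hv
  · exact (m.2 v hv).trans (n.2 v hv).symm

lemma coord_add (m n : C.band ψ) (v : Vtx T.t T.ℓ) :
    C.coord ψ (m + n) v = C.coord ψ m v + C.coord ψ n v := rfl

lemma coord_smul (c : k) (m : C.band ψ) (v : Vtx T.t T.ℓ) :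
    C.coord ψ (c • m) v = c • C.coord ψ m v := rfl

lemma coord_zero (v : Vtx T.t T.ℓ) : C.coord ψ 0 v = 0 := rfl

/-- The inclusion of the space of the band module at a live vertex. -/
def inc {v : Vtx T.t T.ℓ} (hv : C.Live v) : Λ →ₗ[k] C.band ψ where
  toFun x := ⟨(Pi.single v x : Vtx T.t T.ℓ → Λ), C.isSupported_single hv x⟩
  map_add' x y := Subtype.ext (Pi.single_add (f := fun _ : Vtx T.t T.ℓ => Λ) v x y)
  map_smul' c x := Subtype.ext (Pi.single_smul (f := fun _ : Vtx T.t T.ℓ => Λ) v c x)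

lemma coord_inc_self {v : Vtx T.t T.ℓ} (hv : C.Live v) (x : Λ) :
    C.coord ψ (C.inc ψ hv x) v = x := Pi.single_eq_same (M := fun _ : Vtx T.t T.ℓ => Λ) v x

lemma smul_eq_inc {x : PathAlg k T.t T.ℓ} {u v : Vtx T.t T.ℓ} (hv : C.Live v) {g : Λ}
    (hx : matRep (C.scal ψ) x = Matrix.single u v g) (m : C.band ψ) :
    op (mkA T x) • m = C.inc ψ hv (C.coord ψ m u * g) := by
  refine Subtype.ext ?_
  have key (n : Vtx T.t T.ℓ → Λ) :
      Matrix.vecMul n (matRep (C.scal ψ) x) = Pi.single v (n u * g) := by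
    rw [hx, vecMul_single_apply]
  exact key m.1

lemma actV_smul {v : Vtx T.t T.ℓ} (hv : C.Live v) (m : C.band ψ) :
    actV T v • m = C.inc ψ hv (C.coord ψ m v) := by
  rw [actV, C.smul_eq_inc ψ hv (matRep_eV _ v), mul_one]

section Hom

variable {Λ' : Type u} [CommRing Λ'] [Algebra k Λ'] {ψ' : Alg T →ₗ[k] Λ'}
variable {ψ} (h : C.band ψ →ₗ[(Alg T)ᵐᵒᵖ] C.band ψ')

lemma map_inc {u v : Vtx T.t T.ℓ} (hu : C.Live u) (hv : C.Live v) {x : PathAlg k T.t T.ℓ}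
    {g : Λ} {g' : Λ'} (hx : matRep (C.scal ψ) x = Matrix.single u v g)
    (hx' : matRep (C.scal ψ') x = Matrix.single u v g') (y : Λ) :
    C.coord ψ' (h (C.inc ψ hv (y * g))) v = C.coord ψ' (h (C.inc ψ hu y)) u * g' := by
  have := C.smul_eq_inc ψ hv hx (C.inc ψ hu y)
  rw [coord_inc_self] at this
  rw [← this, map_smul, C.smul_eq_inc ψ' hv hx', coord_inc_self]

lemma live_src : C.Live .src := trivial

lemma live_snk : C.Live .snk := trivial

/-- The component at the source of a homomorphism between band modules. -/
def comp : Λ →ₗ[k] Λ' where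
  toFun y := C.coord ψ' (h (C.inc ψ C.live_src y)) .src
  map_add' x y := by rw [map_add, map_add, coord_add]
  map_smul' c y := by
    rw [map_smul, ← coord_smul, RingHom.id_apply]
    exact congrArg (fun m => C.coord ψ' m .src) ((h.restrictScalars k).map_smul c _)

variable {x₁ : PathAlg k T.t T.ℓ} (h₁ : ψ (mkA T (eV .src * x₁ * eV .snk)) = 1)
  (h₁' : ψ' (mkA T (eV .src * x₁ * eV .snk)) = 1)

include h₁ h₁'

lemma coord_map_inc_snk (y : Λ) :
    C.coord ψ' (h (C.inc ψ C.live_snk y)) .snk = C.comp h y := by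
  have := C.map_inc h C.live_src C.live_snk (C.matRep_corner ψ x₁) (C.matRep_corner ψ' x₁) y
  rwa [h₁, h₁', mul_one, mul_one] at this

lemma comp_mul {x : PathAlg k T.t T.ℓ} {g : Λ} {g' : Λ'}
    (hg : ψ (mkA T (eV .src * x * eV .snk)) = g)
    (hg' : ψ' (mkA T (eV .src * x * eV .snk)) = g') (y : Λ) :
    C.comp h (y * g) = C.comp h y * g' := by
  have := C.map_inc h C.live_src C.live_snk (C.matRep_corner ψ x) (C.matRep_corner ψ' x) y
  rw [C.coord_map_inc_snk h h₁ h₁'] at this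
  rw [← hg, ← hg', this]
  rfl

lemma coord_map_inc {v : Vtx T.t T.ℓ} (hv : C.Live v) (y : Λ) :
    C.coord ψ' (h (C.inc ψ hv y)) v = C.comp h y := by
  obtain ⟨i, j, hj, rfl⟩ := exists_eq_vtx ⟨0, by have := T.ht; omega⟩ T.hℓ v
  have hs := vtx_zero (ℓ := T.ℓ) i
  have he := vtx_self (T.hℓ i)
  rcases Nat.eq_zero_or_pos j with rfl | hj0
  · generalize vtx T.t T.ℓ i 0 = v at *
    subst hs
    rfl
  rcases hj.lt_or_eq with hj | rfl
  swap
  · generalize vtx T.t T.ℓ i (T.ℓ i) = v at *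
    subst he
    exact C.coord_map_inc_snk h h₁ h₁' y
  have hl := matRep_subE (k := k) (C.scal ψ) hj0 hj.le
  have hl' := matRep_subE (k := k) (C.scal ψ') hj0 hj.le
  have hr := matRep_subE (k := k) (C.scal ψ) hj le_rfl
  have hr' := matRep_subE (k := k) (C.scal ψ') hj le_rfl
  rw [hs] at hl hl'
  rw [he] at hr hr'
  have hleft : seg (C.scal ψ i) 0 j = 1 → seg (C.scal ψ' i) 0 j = 1 →
      C.coord ψ' (h (C.inc ψ hv y)) (vtx T.t T.ℓ i j) = C.comp h y := by
    intro e e'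
    have := C.map_inc h C.live_src hv hl hl' y
    rwa [e, e', mul_one, mul_one] at this
  by_cases hi : branchInI T i
  · rcases C.of_live_vtx hi hj.le hv with hji | hji
    · exact hleft (C.seg_scal_of_branchInI ψ hi (Or.inl hji))
        (C.seg_scal_of_branchInI ψ' hi (Or.inl hji))
    · have := C.map_inc h hv C.live_snk hr hr' y
      rw [C.seg_scal_of_branchInI ψ hi (Or.inr hji), C.seg_scal_of_branchInI ψ' hi (Or.inr hji),
        mul_one, mul_one] at this
      rw [← this, C.coord_map_inc_snk h h₁ h₁']
  · exact hleft (C.seg_scal_of_not ψ hi hj) (C.seg_scal_of_not ψ' hi hj)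

lemma coord_map (m : C.band ψ) {v : Vtx T.t T.ℓ} (hv : C.Live v) :
    C.coord ψ' (h m) v = C.comp h (C.coord ψ m v) := by
  rw [← C.coord_map_inc h h₁ h₁' hv, ← C.actV_smul ψ hv, map_smul, C.actV_smul ψ' hv,
    coord_inc_self]

end Hom

end Cut

end Toupie

namespace Toupie

open Polynomial

section Truncated

variable {k : Type u} [Field k]

lemma eq_zero_or_eq_one_of_idem {n : ℕ} {e : AdjoinRoot (X ^ n : k[X])} (he : e * e = e) :
    e = 0 ∨ e = 1 := by
  obtain ⟨p, rfl⟩ := AdjoinRoot.mk_surjective e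
  have hdvd : (X ^ n : k[X]) ∣ p * (p - 1) := by
    rw [← AdjoinRoot.mk_eq_zero, map_mul, map_sub, map_one, mul_sub, he, mul_one, sub_self]
  by_cases hX : (X : k[X]) ∣ p
  · left
    have hX' : ¬ (X : k[X]) ∣ p - 1 := fun h =>
      prime_X.not_isUnit (isUnit_of_dvd_one (by simpa using dvd_sub hX h))
    exact AdjoinRoot.mk_eq_zero.2 (prime_X.pow_dvd_of_dvd_mul_right n hX' hdvd)
  · right
    rw [← sub_eq_zero, ← map_one (AdjoinRoot.mk _), ← map_sub]
    exact AdjoinRoot.mk_eq_zero.2 (prime_X.pow_dvd_of_dvd_mul_left n hX hdvd)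

lemma map_mul_one_of_root {n : ℕ} {h : AdjoinRoot (X ^ n : k[X]) →ₗ[k] AdjoinRoot (X ^ n : k[X])}
    (hX : ∀ y, h (y * AdjoinRoot.mk _ X) = h y * AdjoinRoot.mk _ X)
    (y : AdjoinRoot (X ^ n : k[X])) : h y = y * h 1 := by
  obtain ⟨p, rfl⟩ := AdjoinRoot.mk_surjective y
  induction p using Polynomial.induction_on with
  | C a =>
    rw [AdjoinRoot.mk_C, ← AdjoinRoot.algebraMap_eq, Algebra.algebraMap_eq_smul_one, map_smul,
      smul_mul_assoc, one_mul]
  | add p q hp hq => rw [map_add, map_add, hp, hq, add_mul]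
  | monomial m a ih => rw [pow_succ, ← mul_assoc, map_mul, hX, ih, mul_right_comm]

lemma finrank_truncated (n : ℕ) : Module.finrank k (AdjoinRoot (X ^ n : k[X])) = n := by
  rw [(AdjoinRoot.powerBasis' (monic_X_pow n)).finrank]
  simp

lemma finite_truncated (n : ℕ) : Module.Finite k (AdjoinRoot (X ^ n : k[X])) :=
  (AdjoinRoot.powerBasis' (monic_X_pow n)).finite

end Truncated

variable {k : Type u} [Field k] {T : ToupieAlg k}

lemma exists_functional (hm : 2 ≤ mDim T) : ∃ (φ : Alg T →ₗ[k] k[X]) (x₁ x₂ : PathAlg k T.t T.ℓ),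
    φ (mkA T (eV .src * x₁ * eV .snk)) = 1 ∧ φ (mkA T (eV .src * x₂ * eV .snk)) = X := by
  have hm' : 2 ≤ Module.finrank k ↥(LinearMap.range (lrMap T)) := hm
  have : Module.Finite k ↥(LinearMap.range (lrMap T)) :=
    Module.finite_of_finrank_pos (by omega)
  let b := Module.finBasis k ↥(LinearMap.range (lrMap T))
  let g : ↥(LinearMap.range (lrMap T)) →ₗ[k] k[X] :=
    b.constr k fun i => if i.1 = 0 then 1 else X
  have hidem : ∀ y, lrMap T (lrMap T y) = lrMap T y := by
    intro y
    have hS := isPathSystem k T.t T.ℓ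
    have h1 : e0 T * e0 T = e0 T := by
      rw [e0, ← map_mul, hS.idem, if_pos rfl]
    have h2 : einf T * einf T = einf T := by
      rw [einf, ← map_mul, hS.idem, if_pos rfl]
    change e0 T * (e0 T * y * einf T) * einf T = e0 T * y * einf T
    rw [mul_assoc, mul_assoc, h2, ← mul_assoc, ← mul_assoc, h1]
  have key : ∀ i : Fin (Module.finrank k ↥(LinearMap.range (lrMap T))), ∃ x,
      g ((lrMap T).rangeRestrict (mkA T (eV .src * x * eV .snk))) =
      if i.1 = 0 then 1 else X := by
    intro i
    obtain ⟨y, hy⟩ := (b i).2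
    obtain ⟨x, rfl⟩ := mkA_surjective T y
    refine ⟨x, ?_⟩
    have : (lrMap T).rangeRestrict (mkA T (eV .src * x * eV .snk)) = b i := by
      rw [map_mul (mkA T), map_mul (mkA T)]
      refine Subtype.ext ?_
      exact (hidem (mkA T x)).trans hy
    rw [this]
    exact b.constr_basis k _ i
  obtain ⟨x₁, h₁⟩ := key ⟨0, by omega⟩
  obtain ⟨x₂, h₂⟩ := key ⟨1, by omega⟩
  exact ⟨g.comp (lrMap T).rangeRestrict, x₁, x₂, by simpa using h₁, by simpa using h₂⟩

/-- The reduction of a `k[X]`-valued linear map modulo `X ^ n`. -/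
def trunc (φ : Alg T →ₗ[k] k[X]) (n : ℕ) : Alg T →ₗ[k] AdjoinRoot (X ^ n : k[X]) :=
  (AdjoinRoot.mkₐ (X ^ n : k[X])).toLinearMap.comp φ

lemma trunc_eq {φ : Alg T →ₗ[k] k[X]} {x : Alg T} {p : k[X]} (h : φ x = p) (n : ℕ) :
    trunc φ n x = AdjoinRoot.mk _ p := by rw [← h]; rfl

namespace Cut

variable (C : Cut T)

/-- The band module with parameter `X` on `k[X] / X ^ n`. -/
abbrev bandMod (φ : Alg T →ₗ[k] k[X]) (n : ℕ) : ModuleCat.{u} (Alg T)ᵐᵒᵖ :=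
  ModuleCat.of (Alg T)ᵐᵒᵖ (C.band (trunc φ n))

variable {φ : Alg T →ₗ[k] k[X]} {x₁ x₂ : PathAlg k T.t T.ℓ}

lemma fdMod_bandMod (n : ℕ) : FdMod (Alg T)ᵐᵒᵖ (C.bandMod φ n) := by
  have := finite_truncated (k := k) n
  have h1 : Module.Finite k (Vtx T.t T.ℓ → AdjoinRoot (X ^ n : k[X])) := inferInstance
  have h2 : Module.Finite k (C.Row (trunc φ n)) := h1
  have h3 : Module.Finite k ((C.band (trunc φ n)).restrictScalars k) := inferInstance
  have h4 : Module.Finite k (C.band (trunc φ n)) := h3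
  exact Module.Finite.of_restrictScalars_finite k _ _

lemma indec_bandMod (h₁ : φ (mkA T (eV .src * x₁ * eV .snk)) = 1)
    (h₂ : φ (mkA T (eV .src * x₂ * eV .snk)) = X) {n : ℕ} (hn : 0 < n) :
    Indec (Alg T)ᵐᵒᵖ (C.bandMod φ n) := by
  have h1 := trunc_eq h₁ n
  have h2 := trunc_eq h₂ n
  rw [map_one] at h1
  constructor
  · have : Nontrivial (AdjoinRoot (X ^ n : k[X])) :=
      Module.nontrivial_of_finrank_pos (R := k) (by rwa [finrank_truncated])
    refine ⟨⟨C.inc _ C.live_src 1, 0, fun h => ?_⟩⟩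
    have := congrArg (fun m => C.coord (trunc φ n) m .src) h
    simp only [coord_inc_self, coord_zero] at this
    exact one_ne_zero this
  · intro f hf
    let f' : C.band (trunc φ n) →ₗ[(Alg T)ᵐᵒᵖ] C.band (trunc φ n) := f
    have hmul := map_mul_one_of_root (C.comp_mul f' h1 h1 h2 h2)
    have hco := fun m v hv => C.coord_map f' h1 h1 m (v := v) hv
    have hidem : C.comp f' (C.comp f' 1) = C.comp f' 1 := by
      have := congrArg (fun g : C.band (trunc φ n) →ₗ[(Alg T)ᵐᵒᵖ] C.band (trunc φ n) =>
        C.coord _ (g (C.inc _ C.live_src 1)) .src) hf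
      simp only [LinearMap.comp_apply] at this
      rw [hco _ _ C.live_src] at this
      exact this
    rw [hmul] at hidem
    rcases eq_zero_or_eq_one_of_idem hidem with h | h
    · left
      refine LinearMap.ext fun m => C.band_ext fun v hv => ?_
      rw [hco m v hv, hmul, h, mul_zero]
      rfl
    · right
      refine LinearMap.ext fun m => C.band_ext fun v hv => ?_
      rw [hco m v hv, hmul, h, mul_one]
      rfl

lemma le_of_equiv (h₁ : φ (mkA T (eV .src * x₁ * eV .snk)) = 1) {m n : ℕ}
    (e : C.bandMod φ m ≃ₗ[(Alg T)ᵐᵒᵖ] C.bandMod φ n) : m ≤ n := by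
  have h1 := trunc_eq h₁ m
  have h1' := trunc_eq h₁ n
  rw [map_one] at h1 h1'
  let f : C.band (trunc φ m) →ₗ[(Alg T)ᵐᵒᵖ] C.band (trunc φ n) := e.toLinearMap
  have := finite_truncated (k := k) n
  rw [← finrank_truncated (k := k) m, ← finrank_truncated (k := k) n]
  refine LinearMap.finrank_le_finrank_of_injective (f := C.comp f) ?_
  rw [injective_iff_map_eq_zero]
  intro y hy
  have h0 : f (C.inc _ C.live_src y) = f 0 := by
    refine C.band_ext fun v hv => ?_
    rw [C.coord_map f h1 h1' _ hv, C.coord_map f h1 h1' _ hv, coord_zero, map_zero]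
    by_cases hvs : v = .src
    · subst hvs
      rw [coord_inc_self, hy]
    · have : C.coord _ (C.inc (trunc φ m) C.live_src y) v = 0 := Pi.single_eq_of_ne hvs _
      rw [this, map_zero]
  have h0' := e.injective h0
  have := congrArg (fun z => C.coord (trunc φ m) z .src) h0'
  simpa only [coord_inc_self, coord_zero] using this

variable {i : Fin T.t}

lemma not_pdLeOne_bandMod (hi : branchInI T i) {n : ℕ} (hn : 0 < n) :
    ¬ PdLeOne (Alg T)ᵐᵒᵖ (C.bandMod φ n) := by
  obtain ⟨d, had, hd, hI, hI', hlt⟩ := C.isStart i hi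
  have hab := C.fst_add_two_le hi
  have hbℓ := C.lst_le hi
  have hv : C.Live (vtx T.t T.ℓ i (C.fst i)) := C.live_vtx fun _ => Or.inl le_rfl
  have : Nontrivial (AdjoinRoot (X ^ n : k[X])) :=
    Module.nontrivial_of_finrank_pos (R := k) (by rwa [finrank_truncated])
  refine not_pdLeOne_of_start (C.bandMod φ n) had hd hI hI' hlt
    (w := C.inc (trunc φ n) hv 1) ?_ ?_ ?_
  · exact (C.actV_smul _ hv _).trans (by rw [coord_inc_self])
  · intro h
    have := congrArg (fun m => C.coord (trunc φ n) m (vtx T.t T.ℓ i (C.fst i))) h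
    simp only [coord_inc_self] at this
    exact one_ne_zero this
  · have hx : matRep (C.scal (trunc φ n)) (arE i (C.fst i) : PathAlg k T.t T.ℓ) =
        Matrix.single Vtx.src Vtx.src 0 := by
      rw [matRep_arE _ (by omega), scal, if_pos hi, if_neg (by omega), Matrix.single_zero,
        Matrix.single_zero]
    refine (C.smul_eq_inc _ C.live_src hx _).trans ?_
    rw [mul_zero, map_zero]

lemma not_idLeOne_bandMod (hi : branchInI T i) {n : ℕ} (hn : 0 < n) :
    ¬ IdLeOne (Alg T)ᵐᵒᵖ (C.bandMod φ n) := by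
  obtain ⟨a, had, hd, hI, hI', hlt⟩ := C.isEnd i hi
  have hab := C.fst_add_two_le hi
  have hv : C.Live (vtx T.t T.ℓ i (C.lst i)) := C.live_vtx fun _ => Or.inr le_rfl
  obtain ⟨b, hb⟩ : ∃ b, C.lst i = b + 1 := ⟨C.lst i - 1, by omega⟩
  have : Nontrivial (AdjoinRoot (X ^ n : k[X])) :=
    Module.nontrivial_of_finrank_pos (R := k) (by rwa [finrank_truncated])
  rw [hb] at had hd hI hI' hv
  refine not_idLeOne_of_end (C.bandMod φ n) had hd hI hI' hlt
    (w := C.inc (trunc φ n) hv 1) ?_ ?_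
  · exact (C.actV_smul _ hv _).trans (by rw [coord_inc_self])
  · intro m h
    have hx : matRep (C.scal (trunc φ n)) (arE i b : PathAlg k T.t T.ℓ) =
        Matrix.single Vtx.src Vtx.src 0 := by
      rw [matRep_arE _ (by omega), scal, if_pos hi, if_neg (by omega), Matrix.single_zero,
        Matrix.single_zero]
    have h0 := (C.smul_eq_inc _ C.live_src hx m).symm.trans h
    rw [mul_zero, map_zero] at h0
    have := congrArg (fun m => C.coord (trunc φ n) m (vtx T.t T.ℓ i (b + 1))) h0
    simp only [coord_inc_self] at this
    exact zero_ne_one this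

end Cut

end Toupie

namespace Toupie

/-- A non simply connected toupie algebra with
`m = dim_k e₀ A e∞ ≥ 2`, some branch of which lies in the ideal `I`, is not a laura
algebra. -/
theorem not_laura_of_branch_in_ideal_of_two_le_mDim {k : Type u} [Field k]
    (T : ToupieAlg k) (hnsc : ¬ SimplyConnected T) (hm : 2 ≤ mDim T)
    (hb : ∃ i : Fin T.t, branchInI T i) :
    ¬ Laura (Alg T)ᵐᵒᵖ := by
  rintro ⟨S, hS, hL⟩
  obtain ⟨C⟩ := nonempty_cut T
  obtain ⟨φ, x₁, x₂, h₁, h₂⟩ := exists_functional hm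
  obtain ⟨i, hi⟩ := hb
  have key (n : ℕ) : ∃ N ∈ S, Nonempty (C.bandMod φ (n + 1) ≃ₗ[(Alg T)ᵐᵒᵖ] N) := by
    have hind := C.indec_bandMod h₁ h₂ n.succ_pos
    have hfd := C.fdMod_bandMod (φ := φ) (n + 1)
    exact hL _ hind hfd
      (fun h => C.not_pdLeOne_bandMod hi n.succ_pos (h.2.2 _ hind hfd .refl))
      (fun h => C.not_idLeOne_bandMod hi n.succ_pos (h.2.2 _ hind hfd .refl))
  choose N hN e using key
  have := hS.to_subtype
  obtain ⟨m, n, hne, heq⟩ := Finite.exists_ne_map_eq_of_infinite fun n => (⟨N n, hN n⟩ : S)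
  have heq : N m = N n := congrArg Subtype.val heq
  obtain ⟨f⟩ := e m
  obtain ⟨g⟩ := e n
  rw [← heq] at g
  have h1 := C.le_of_equiv h₁ (f.trans g.symm)
  have h2 := C.le_of_equiv h₁ (g.trans f.symm)
  omega

end Toupie
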